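/- Let γ > 0 be real, let 0 < a < 1, let k, l ∈ ℤ, set z = q/(a·γ) and w(x) = (−q·x;q)_∞ / (−a·x;q)_∞. Then the family j ↦ q^j · w(−q^j) · J_{γq^k}(−q^j;a;q) · J_{γq^l}(−q^j;a;q) is summable over j ∈ ℤ≥0, the family j ↦ q^j · w(z·q^j) · J_{γq^k}(z·q^j;a;q) · J_{γq^l}(z·q^j;a;q) is summable over j ∈ ℤ, and (1−q)·[∑_{j=0}^∞ q^j · w(−q^j) · J_{γq^k}(−q^j;a;q) · J_{γq^l}(−q^j;a;q) + z·∑_{j∈ℤ} q^j · w(z·q^j) · J_{γq^k}(z·q^j;a;q) · J_{γq^l}(z·q^j;a;q)] = δ_{k,l} · (1−q) · a^{−k} · (−q^k·γ;q)_∞ · (q;q)_∞² · θ(−a·γ) / ((a;q)_∞² · θ(−γ)), where δ_{k,l} is the Kronecker delta. -/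

import Mathlib

/-- The q-shifted factorial `(a;q)_n = ∏_{j=0}^{n-1} (1 - a q^j)`. -/
noncomputable def qPoch (a q : ℂ) (n : ℕ) : ℂ := ∏ j ∈ Finset.range n, (1 - a * q ^ j)

/-- The infinite q-shifted factorial `(a;q)_∞ = ∏_{j=0}^∞ (1 - a q^j)`. -/
noncomputable def qPochInf (a q : ℂ) : ℂ := ∏' j : ℕ, (1 - a * q ^ j)

/-- The theta function `θ(y) = (y;q)_∞ (q/y;q)_∞`. -/
noncomputable def qTheta (q y : ℂ) : ℂ := qPochInf y q * qPochInf (q / y) q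

/-- The weight `w(x) = (-qx;q)_∞ / (-ax;q)_∞`. -/
noncomputable def bigQWeight (q a y : ℂ) : ℂ := qPochInf (-(q * y)) q / qPochInf (-(a * y)) q

/-- The big q-Bessel function
`J_γ(x;a;q) = ∑ (-1/x;q)_n (-1)^n q^{n(n-1)/2} / ((a;q)_n (q;q)_n) (aγx)^n`. -/
noncomputable def bigQBessel (q a γ x : ℂ) : ℂ :=
  ∑' n : ℕ, qPoch (-1 / x) q n * (-1) ^ n * q ^ (n * (n - 1) / 2) /
    (qPoch a q n * qPoch q q n) * (a * γ * x) ^ n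

open Filter Topology Finset

/-! ### Infinite and finite `q`-shifted factorials -/

section QPochhammer

variable {q : ℂ}

lemma summable_norm_mul_pow (hq : ‖q‖ < 1) (x : ℂ) : Summable fun j : ℕ => ‖-(x * q ^ j)‖ := by
  simpa [norm_mul, norm_pow] using
    (summable_geometric_of_lt_one (norm_nonneg q) hq).mul_left ‖x‖

lemma multipliable_qPochInf (hq : ‖q‖ < 1) (x : ℂ) :
    Multipliable fun j : ℕ => 1 - x * q ^ j := by
  simpa [sub_eq_add_neg] using multipliable_one_add_of_summable (summable_norm_mul_pow hq x)

lemma tendsto_qPoch (hq : ‖q‖ < 1) (x : ℂ) :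
    Tendsto (fun n => qPoch x q n) atTop (𝓝 (qPochInf x q)) :=
  (multipliable_qPochInf hq x).hasProd.tendsto_prod_nat

@[simp] lemma qPoch_zero (x : ℂ) : qPoch x q 0 = 1 := by simp [qPoch]

lemma qPoch_succ (x : ℂ) (n : ℕ) : qPoch x q (n + 1) = qPoch x q n * (1 - x * q ^ n) := by
  simp [qPoch, prod_range_succ]

lemma qPoch_succ' (x : ℂ) (n : ℕ) : qPoch x q (n + 1) = (1 - x) * qPoch (x * q) q n := by
  simp only [qPoch, prod_range_succ', pow_zero, mul_one]
  rw [mul_comm]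
  congr 1
  exact prod_congr rfl fun j _ => by ring

lemma qPochInf_eq_qPoch_mul (hq : ‖q‖ < 1) (x : ℂ) (n : ℕ) :
    qPochInf x q = qPoch x q n * qPochInf (x * q ^ n) q := by
  have e : ∀ j : ℕ, 1 - x * q ^ n * q ^ j = 1 - x * q ^ (j + n) := fun j => by ring
  have h := multipliable_qPochInf hq (x * q ^ n)
  simp only [e] at h
  simp only [qPochInf, qPoch, e]
  exact (Multipliable.prod_mul_tprod_nat_mul' (f := fun j : ℕ => 1 - x * q ^ j) h).symm

lemma qPochInf_eq_one_sub_mul (hq : ‖q‖ < 1) (x : ℂ) :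
    qPochInf x q = (1 - x) * qPochInf (x * q) q := by
  simpa [qPoch] using qPochInf_eq_qPoch_mul hq x 1

lemma qPochInf_eq_zero (hq : ‖q‖ < 1) {x : ℂ} {n : ℕ} (h : x * q ^ n = 1) :
    qPochInf x q = 0 := by
  rw [qPochInf_eq_qPoch_mul hq x (n + 1), qPoch_succ, h]
  simp

lemma qPochInf_ne_zero (hq : ‖q‖ < 1) {x : ℂ} (h : ∀ n : ℕ, x * q ^ n ≠ 1) :
    qPochInf x q ≠ 0 := by
  have := tprod_one_add_ne_zero_of_summable (f := fun j : ℕ => -(x * q ^ j))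
    (fun j h0 => h j (by linear_combination -h0)) (summable_norm_mul_pow hq x)
  simpa [qPochInf, sub_eq_add_neg] using this

lemma qPochInf_ne_zero_of_norm_lt_one (hq : ‖q‖ < 1) {x : ℂ} (h : ‖x‖ < 1) :
    qPochInf x q ≠ 0 := by
  refine qPochInf_ne_zero hq fun n hn => ?_
  have h1 : ‖x * q ^ n‖ < 1 := by
    rw [norm_mul, norm_pow]
    exact mul_lt_one_of_nonneg_of_lt_one_left (norm_nonneg _) h
      (pow_le_one₀ (norm_nonneg _) hq.le)
  rw [hn] at h1
  simp at h1

lemma qPoch_ne_zero_of_norm_lt_one (hq : ‖q‖ < 1) {x : ℂ} (h : ‖x‖ < 1) (n : ℕ) :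
    qPoch x q n ≠ 0 := by
  have := qPochInf_ne_zero_of_norm_lt_one hq h
  rw [qPochInf_eq_qPoch_mul hq x n] at this
  exact left_ne_zero_of_mul this

lemma sum_norm_mul_pow_le (hq : ‖q‖ < 1) (x : ℂ) (n : ℕ) :
    ∑ j ∈ range n, ‖-(x * q ^ j)‖ ≤ ‖x‖ / (1 - ‖q‖) := by
  refine ((summable_norm_mul_pow hq x).sum_le_tsum _ fun j _ => norm_nonneg _).trans ?_
  simp [norm_pow, tsum_mul_left, tsum_geometric_of_lt_one (norm_nonneg q) hq,
    div_eq_mul_inv]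

lemma norm_qPoch_sub_one_le (hq : ‖q‖ < 1) (x : ℂ) (n : ℕ) :
    ‖qPoch x q n - 1‖ ≤ Real.exp (‖x‖ / (1 - ‖q‖)) - 1 := by
  have h := (range n).norm_prod_one_add_sub_one_le fun j => -(x * q ^ j)
  simp only [← sub_eq_add_neg] at h
  refine h.trans (sub_le_sub_right (Real.exp_le_exp.2 (sum_norm_mul_pow_le hq x n)) 1)

lemma norm_qPochInf_sub_one_le (hq : ‖q‖ < 1) (x : ℂ) :
    ‖qPochInf x q - 1‖ ≤ Real.exp (‖x‖ / (1 - ‖q‖)) - 1 :=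
  le_of_tendsto ((tendsto_qPoch hq x).sub_const 1).norm
    (Eventually.of_forall (norm_qPoch_sub_one_le hq x))

lemma norm_qPoch_le (hq : ‖q‖ < 1) {x : ℂ} {r : ℝ} (hx : ‖x‖ ≤ r) (n : ℕ) :
    ‖qPoch x q n‖ ≤ Real.exp (r / (1 - ‖q‖)) := by
  have h1 := norm_qPoch_sub_one_le hq x n
  have h2 := norm_le_norm_sub_add (qPoch x q n) 1
  have h3 : ‖x‖ / (1 - ‖q‖) ≤ r / (1 - ‖q‖) :=
    div_le_div_of_nonneg_right hx (sub_nonneg.2 hq.le)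
  have h4 := Real.exp_le_exp.2 h3
  rw [norm_one] at h2
  linarith

lemma norm_qPochInf_le (hq : ‖q‖ < 1) {x : ℂ} {r : ℝ} (hx : ‖x‖ ≤ r) :
    ‖qPochInf x q‖ ≤ Real.exp (r / (1 - ‖q‖)) :=
  le_of_tendsto (tendsto_qPoch hq x).norm (Eventually.of_forall (norm_qPoch_le hq hx))

lemma tendsto_exp_norm_sub_one {u : ℕ → ℂ} (hu : Tendsto u atTop (𝓝 0)) (c : ℝ) :
    Tendsto (fun n => Real.exp (‖u n‖ / c) - 1) atTop (𝓝 0) := by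
  have h : Tendsto (fun n => Real.exp (‖u n‖ / c) - 1) atTop (𝓝 (Real.exp (‖(0 : ℂ)‖ / c) - 1)) :=
    ((Real.continuous_exp.tendsto _).comp (hu.norm.div_const c)).sub_const 1
  simpa using h

lemma tendsto_qPochInf_one (hq : ‖q‖ < 1) {u : ℕ → ℂ} (hu : Tendsto u atTop (𝓝 0)) :
    Tendsto (fun n => qPochInf (u n) q) atTop (𝓝 1) := by
  rw [tendsto_iff_norm_sub_tendsto_zero]
  exact squeeze_zero (fun _ => norm_nonneg _) (fun n => norm_qPochInf_sub_one_le hq (u n))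
    (tendsto_exp_norm_sub_one hu _)

lemma tendsto_qPoch_one (hq : ‖q‖ < 1) {u : ℕ → ℂ} (hu : Tendsto u atTop (𝓝 0)) (j : ℕ) :
    Tendsto (fun n => qPoch (u n) q j) atTop (𝓝 1) := by
  rw [tendsto_iff_norm_sub_tendsto_zero]
  exact squeeze_zero (fun _ => norm_nonneg _) (fun n => norm_qPoch_sub_one_le hq (u n) j)
    (tendsto_exp_norm_sub_one hu _)

lemma tendsto_mul_pow_zero (hq : ‖q‖ < 1) (x : ℂ) :
    Tendsto (fun n : ℕ => x * q ^ n) atTop (𝓝 0) := by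
  simpa using (tendsto_pow_atTop_nhds_zero_of_norm_lt_one hq).const_mul x

/-- Reciprocals of finite `q`-shifted factorials with nonvanishing limit are bounded. -/
lemma norm_inv_qPoch_le (hq : ‖q‖ < 1) {x : ℂ} (h : ‖x‖ < 1) (n : ℕ) :
    ‖(qPoch x q n)⁻¹‖ ≤ Real.exp (1 / (1 - ‖q‖)) / ‖qPochInf x q‖ := by
  have h0 := qPochInf_ne_zero_of_norm_lt_one hq h
  have h1 := qPoch_ne_zero_of_norm_lt_one hq h n
  have h2 : (qPoch x q n)⁻¹ = qPochInf (x * q ^ n) q / qPochInf x q := by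
    rw [eq_div_iff h0, qPochInf_eq_qPoch_mul hq x n]
    field_simp
  rw [h2, norm_div]
  refine div_le_div_of_nonneg_right (norm_qPochInf_le hq ?_) (norm_nonneg _)
  rw [norm_mul, norm_pow]
  exact mul_le_one₀ h.le (by positivity) (pow_le_one₀ (norm_nonneg _) hq.le)

lemma qPoch_self_succ (n : ℕ) : qPoch q q (n + 1) = qPoch q q n * (1 - q ^ (n + 1)) := by
  rw [qPoch_succ, pow_succ']

/-- The telescoping sum `∑ x q^j (x q^{j+1};q)_∞ = 1 - (x;q)_∞`. -/
lemma hasSum_mul_qPochInf (hq : ‖q‖ < 1) (x : ℂ) :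
    HasSum (fun j : ℕ => x * q ^ j * qPochInf (x * q ^ (j + 1)) q) (1 - qPochInf x q) := by
  have hs : Summable fun j : ℕ => x * q ^ j * qPochInf (x * q ^ (j + 1)) q := by
    refine Summable.of_norm_bounded (g := fun j : ℕ =>
      ‖-(x * q ^ j)‖ * Real.exp (‖x‖ / (1 - ‖q‖))) ((summable_norm_mul_pow hq x).mul_right _) ?_
    intro j
    rw [norm_mul, norm_neg]
    refine mul_le_mul_of_nonneg_left (norm_qPochInf_le hq ?_) (norm_nonneg _)
    rw [norm_mul, norm_pow]
    exact mul_le_of_le_one_right (norm_nonneg _) (pow_le_one₀ (norm_nonneg _) hq.le)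
  have hp : ∀ N, ∑ j ∈ range N, x * q ^ j * qPochInf (x * q ^ (j + 1)) q =
      qPochInf (x * q ^ N) q - qPochInf x q := by
    intro N
    have h := sum_range_sub (fun j => qPochInf (x * q ^ j) q) N
    simp only [pow_zero, mul_one] at h
    rw [← h]
    refine sum_congr rfl fun j _ => ?_
    rw [qPochInf_eq_one_sub_mul hq (x * q ^ j), show x * q ^ j * q = x * q ^ (j + 1) by ring]
    ring
  have h1 := hs.hasSum.tendsto_sum_nat
  simp only [hp] at h1
  have h2 := (tendsto_qPochInf_one hq (tendsto_mul_pow_zero hq x)).sub_const (qPochInf x q)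
  rw [tendsto_nhds_unique h2 h1]
  exact hs.hasSum

end QPochhammer

/-! ### Series with coefficients `q^{n(n-1)/2}` -/

section Series

variable {q : ℂ}

lemma choose_two_succ (n : ℕ) : (n + 1).choose 2 = n.choose 2 + n := by
  rw [Nat.choose_succ_succ' n 1, Nat.choose_one_right, add_comm]

lemma add_choose_two_eq (n m : ℕ) : (n + m).choose 2 = n.choose 2 + m.choose 2 + n * m := by
  induction m with
  | zero => simp
  | succ m ih =>
    rw [← add_assoc, choose_two_succ, ih, choose_two_succ]
    ring

lemma summable_pow_choose_two_mul_pow (hq : ‖q‖ < 1) (r : ℝ) :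
    Summable fun n : ℕ => ‖q‖ ^ n.choose 2 * r ^ n := by
  rcases eq_or_ne r 0 with rfl | hr
  · exact summable_of_ne_finset_zero (s := {0}) fun n hn => by simp_all
  rcases eq_or_ne q 0 with rfl | hq0
  · refine summable_of_ne_finset_zero (s := {0, 1}) fun n hn => ?_
    have : 2 ≤ n := by simp at hn; omega
    simp [(Nat.choose_pos this).ne']
  have hq0' : ‖q‖ ≠ 0 := norm_ne_zero_iff.2 hq0
  refine summable_of_ratio_test_tendsto_lt_one (l := 0) zero_lt_one
    (Eventually.of_forall fun n => by positivity) ?_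
  have : ∀ n : ℕ, ‖‖q‖ ^ (n + 1).choose 2 * r ^ (n + 1)‖ / ‖‖q‖ ^ n.choose 2 * r ^ n‖ =
      |r| * ‖q‖ ^ n := by
    intro n
    rw [choose_two_succ, ← norm_div, pow_add, pow_succ]
    have : ‖q‖ ^ n.choose 2 * ‖q‖ ^ n * (r ^ n * r) / (‖q‖ ^ n.choose 2 * r ^ n) = r * ‖q‖ ^ n := by
      field_simp
    rw [this]
    simp
  simp only [this]
  simpa using (tendsto_pow_atTop_nhds_zero_of_lt_one (norm_nonneg q) hq).const_mul |r|

/-- Coefficient of `y^n` in Euler's expansion of `(-y;q)_∞`. -/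
noncomputable def eulerCoeff (q : ℂ) (n : ℕ) : ℂ := q ^ n.choose 2 / qPoch q q n

lemma norm_eulerCoeff_le (hq : ‖q‖ < 1) :
    ∃ C : ℝ, 0 ≤ C ∧ ∀ n, ‖eulerCoeff q n‖ ≤ C * ‖q‖ ^ n.choose 2 := by
  refine ⟨Real.exp (1 / (1 - ‖q‖)) / ‖qPochInf q q‖, by positivity, fun n => ?_⟩
  rw [eulerCoeff, div_eq_mul_inv, norm_mul, norm_pow, mul_comm]
  exact mul_le_mul_of_nonneg_right (norm_inv_qPoch_le hq hq n) (by positivity)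

lemma summable_norm_eulerCoeff_mul_pow (hq : ‖q‖ < 1) (r : ℝ) :
    Summable fun n => ‖eulerCoeff q n‖ * |r| ^ n := by
  obtain ⟨C, -, hC⟩ := norm_eulerCoeff_le hq
  refine Summable.of_nonneg_of_le (fun n => by positivity) (fun n => ?_)
    ((summable_pow_choose_two_mul_pow hq |r|).mul_left C)
  rw [← mul_assoc]
  exact mul_le_mul_of_nonneg_right (hC n) (by positivity)

lemma eulerCoeff_succ (hq : ‖q‖ < 1) (n : ℕ) :
    eulerCoeff q (n + 1) * (1 - q ^ (n + 1)) = q ^ n * eulerCoeff q n := by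
  have h1 := qPoch_ne_zero_of_norm_lt_one hq hq n
  have h2 := qPoch_ne_zero_of_norm_lt_one hq hq (n + 1)
  rw [qPoch_self_succ] at h2
  have h3 := right_ne_zero_of_mul h2
  rw [eulerCoeff, eulerCoeff, choose_two_succ, qPoch_self_succ, pow_add]
  field_simp

/-- Euler's expansion `(y;q)_∞ = ∑ q^{n(n-1)/2} (-y)^n / (q;q)_n`. -/
lemma hasSum_eulerCoeff (hq : ‖q‖ < 1) (y : ℂ) :
    HasSum (fun n => eulerCoeff q n * (-y) ^ n) (qPochInf y q) := by
  set f : ℂ → ℂ := fun y => ∑' n, eulerCoeff q n * (-y) ^ n with hf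
  have hs : ∀ y : ℂ, Summable fun n => eulerCoeff q n * (-y) ^ n := fun y =>
    Summable.of_norm (by simpa using summable_norm_eulerCoeff_mul_pow hq ‖y‖)
  have hstep : ∀ y, f y = (1 - y) * f (y * q) := by
    intro y
    have h1 : f y - f (y * q) = ∑' n, eulerCoeff q n * (1 - q ^ n) * (-y) ^ n := by
      rw [hf]
      simp only
      rw [← (hs y).tsum_sub (hs (y * q))]
      refine tsum_congr fun n => ?_
      rw [← neg_mul, mul_pow]
      ring
    have hs' : Summable fun n => eulerCoeff q n * (1 - q ^ n) * (-y) ^ n := by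
      refine ((hs y).sub (hs (y * q))).congr fun n => ?_
      rw [← neg_mul, mul_pow]
      ring
    have h2 : ∑' n, eulerCoeff q n * (1 - q ^ n) * (-y) ^ n = -y * f (y * q) := by
      rw [hs'.tsum_eq_zero_add, hf]
      simp only [pow_zero, sub_self, mul_zero, zero_mul, zero_add]
      rw [← tsum_mul_left]
      refine tsum_congr fun n => ?_
      rw [eulerCoeff_succ hq, ← neg_mul, mul_pow]
      ring
    linear_combination h1 + h2
  have hiter : ∀ n, f y = qPoch y q n * f (y * q ^ n) := by
    intro n
    induction n with
    | zero => simp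
    | succ n ih =>
      rw [ih, hstep (y * q ^ n), qPoch_succ, pow_succ]
      ring_nf
  have hlim : Tendsto (fun n : ℕ => f (y * q ^ n)) atTop (𝓝 1) := by
    have h0 : (∑' n, eulerCoeff q n * (0 : ℂ) ^ n) = 1 := by
      rw [tsum_eq_single 0 fun n hn => by simp [hn]]
      simp [eulerCoeff]
    rw [← h0]
    refine tendsto_tsum_of_dominated_convergence
      (summable_norm_eulerCoeff_mul_pow hq ‖y‖) (fun k => ?_) (Eventually.of_forall fun n k => ?_)
    · refine Tendsto.const_mul _ (Tendsto.pow ?_ k)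
      simpa using (tendsto_mul_pow_zero hq y).neg
    · rw [norm_mul, norm_pow, norm_neg, norm_mul, norm_pow, abs_norm]
      gcongr
      exact mul_le_of_le_one_right (norm_nonneg _) (pow_le_one₀ (norm_nonneg _) hq.le)
  have h3 : Tendsto (fun n => qPoch y q n * f (y * q ^ n)) atTop (𝓝 (qPochInf y q * 1)) :=
    (tendsto_qPoch hq y).mul hlim
  have h4 : f y = qPochInf y q := by
    simp only [← hiter, mul_one] at h3
    exact tendsto_nhds_unique tendsto_const_nhds h3
  rw [← h4]
  exact (hs y).hasSum

end Series

/-! ### The finite `q`-binomial theorem as an identity of formal power series -/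

section Binomial

variable {q : ℂ}

/-- The homogeneous product `∏_{j<n} (x + y q^j)`. -/
noncomputable def qBinomProd (q x y : ℂ) (n : ℕ) : ℂ := ∏ j ∈ range n, (x + y * q ^ j)

lemma qBinomProd_succ (x y : ℂ) (n : ℕ) :
    qBinomProd q x y (n + 1) = qBinomProd q x y n * (x + y * q ^ n) := by
  simp [qBinomProd, prod_range_succ]

lemma qBinomProd_mul (c x y : ℂ) (n : ℕ) :
    qBinomProd q (c * x) (c * y) n = c ^ n * qBinomProd q x y n := by
  simp only [qBinomProd, mul_assoc, ← mul_add, prod_mul_distrib, prod_const, card_range]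

lemma qBinomProd_one_left (y : ℂ) (n : ℕ) : qBinomProd q 1 y n = qPoch (-y) q n := by
  simp [qBinomProd, qPoch]

lemma qPoch_mul_pow_eq_qBinomProd {x : ℂ} (hx : x ≠ 0) (n : ℕ) :
    qPoch (-1 / x) q n * x ^ n = qBinomProd q x 1 n := by
  have h := qBinomProd_mul (q := q) x 1 (1 / x) n
  rw [qBinomProd_one_left, mul_one_div_cancel hx, mul_one] at h
  rw [h, mul_comm, neg_div]

lemma norm_qBinomProd_le (hq : ‖q‖ < 1) {x : ℂ} {r : ℝ} (hx : ‖x‖ ≤ r) (n : ℕ) :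
    ‖qBinomProd q x 1 n‖ ≤ (r + 1) ^ n := by
  rw [qBinomProd, norm_prod]
  refine (prod_le_prod (fun _ _ => norm_nonneg _) fun j _ => ?_).trans_eq
    (by rw [prod_const, card_range])
  refine (norm_add_le _ _).trans (add_le_add hx ?_)
  rw [one_mul, norm_pow]
  exact pow_le_one₀ (norm_nonneg _) hq.le

/-- The series `∑ x^n t^n / (q;q)_n`. -/
noncomputable def qExpSeries (q x : ℂ) : PowerSeries ℂ :=
  PowerSeries.mk fun n => x ^ n / qPoch q q n

/-- The series `∑ q^{n(n-1)/2} y^n t^n / (q;q)_n`. -/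
noncomputable def qEulerSeries (q y : ℂ) : PowerSeries ℂ :=
  PowerSeries.mk fun n => y ^ n * eulerCoeff q n

lemma qExpSeries_eq (hq : ‖q‖ < 1) (x : ℂ) :
    qExpSeries q x = PowerSeries.rescale q (qExpSeries q x) +
      PowerSeries.X * (PowerSeries.C x * qExpSeries q x) := by
  ext n
  cases n with
  | zero =>
    rw [map_add, PowerSeries.coeff_zero_X_mul, PowerSeries.coeff_rescale]
    simp
  | succ n =>
    have h1 := qPoch_ne_zero_of_norm_lt_one hq hq n
    have h2 := qPoch_ne_zero_of_norm_lt_one hq hq (n + 1)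
    rw [qPoch_self_succ] at h2
    have h3 := right_ne_zero_of_mul h2
    rw [map_add, PowerSeries.coeff_succ_X_mul, PowerSeries.coeff_C_mul,
      PowerSeries.coeff_rescale]
    simp only [qExpSeries, PowerSeries.coeff_mk]
    rw [qPoch_self_succ]
    field_simp
    ring

lemma qEulerSeries_eq (hq : ‖q‖ < 1) (y : ℂ) :
    qEulerSeries q y = PowerSeries.rescale q (qEulerSeries q y) +
      PowerSeries.X * (PowerSeries.C y * PowerSeries.rescale q (qEulerSeries q y)) := by
  ext n
  cases n with
  | zero =>
    rw [map_add, PowerSeries.coeff_zero_X_mul, PowerSeries.coeff_rescale]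
    simp
  | succ n =>
    rw [map_add, PowerSeries.coeff_succ_X_mul, PowerSeries.coeff_C_mul,
      PowerSeries.coeff_rescale, PowerSeries.coeff_rescale]
    simp only [qEulerSeries, PowerSeries.coeff_mk]
    linear_combination y ^ (n + 1) * eulerCoeff_succ hq n

/-- The finite `q`-binomial theorem. -/
lemma qExpSeries_mul_qEulerSeries (hq : ‖q‖ < 1) (x y : ℂ) :
    qExpSeries q x * qEulerSeries q y =
      PowerSeries.mk fun n => qBinomProd q x y n / qPoch q q n := by
  have hU : qExpSeries q x * qEulerSeries q y - PowerSeries.X * (PowerSeries.C x *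
      (qExpSeries q x * qEulerSeries q y)) =
      PowerSeries.rescale q (qExpSeries q x * qEulerSeries q y) + PowerSeries.X * (PowerSeries.C y *
      PowerSeries.rescale q (qExpSeries q x * qEulerSeries q y)) := by
    rw [map_mul]
    linear_combination qEulerSeries q y * qExpSeries_eq hq x +
      PowerSeries.rescale q (qExpSeries q x) * qEulerSeries_eq hq y
  ext n
  rw [PowerSeries.coeff_mk]
  induction n with
  | zero => simp [qExpSeries, qEulerSeries, qBinomProd, eulerCoeff, PowerSeries.coeff_mul]
  | succ n ih =>
    have h := congrArg (PowerSeries.coeff (n + 1)) hU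
    rw [map_sub, map_add, PowerSeries.coeff_succ_X_mul, PowerSeries.coeff_succ_X_mul,
      PowerSeries.coeff_C_mul, PowerSeries.coeff_C_mul, PowerSeries.coeff_rescale,
      PowerSeries.coeff_rescale, ih] at h
    have h1 := qPoch_ne_zero_of_norm_lt_one hq hq n
    have h2 := qPoch_ne_zero_of_norm_lt_one hq hq (n + 1)
    rw [qPoch_self_succ] at h2 ⊢
    have h3 := right_ne_zero_of_mul h2
    rw [eq_div_iff h2, qBinomProd_succ]
    field_simp at h
    linear_combination h

lemma sum_antidiagonal_qBinomProd (hq : ‖q‖ < 1) (x g : ℂ) (N : ℕ) :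
    ∑ p ∈ antidiagonal N, qBinomProd q x 1 p.1 * g ^ p.1 / qPoch q q p.1 * (1 / qPoch q q p.2) =
      ∑ p ∈ antidiagonal N, (g * x) ^ p.1 / qPoch q q p.1 * (qPoch (-g) q p.2 / qPoch q q p.2) := by
  have h1 := qExpSeries_mul_qEulerSeries hq (g * x) (g * 1)
  have h2 := qExpSeries_mul_qEulerSeries hq 1 (g * 1)
  have h3 : qExpSeries q (g * x) * qEulerSeries q (g * 1) * qExpSeries q 1 =
      qExpSeries q (g * x) * (qExpSeries q 1 * qEulerSeries q (g * 1)) := by ring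
  rw [h1, h2] at h3
  have h4 := congrArg (PowerSeries.coeff N) h3
  rw [PowerSeries.coeff_mul, PowerSeries.coeff_mul] at h4
  simp only [qExpSeries, PowerSeries.coeff_mk, qBinomProd_mul] at h4
  simpa [qBinomProd_one_left, mul_comm] using h4

end Binomial

/-! ### A transformation of the big `q`-Bessel function -/

section Transformation

variable {q : ℂ}

lemma summable_double_choose_two (hq : ‖q‖ < 1) {u v : ℕ → ℂ} {C D r s : ℝ} (hC : 0 ≤ C)
    (hr : 0 ≤ r) (hs : 0 ≤ s)
    (hu : ∀ n, ‖u n‖ ≤ C * r ^ n) (hv : ∀ n, ‖v n‖ ≤ D * s ^ n) (α : ℂ) :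
    Summable fun p : ℕ × ℕ => u p.1 * v p.2 * (α ^ (p.1 + p.2) * q ^ (p.1 + p.2).choose 2) := by
  have hsum := ((summable_pow_choose_two_mul_pow hq (r * ‖α‖)).mul_of_nonneg
    (summable_pow_choose_two_mul_pow hq (s * ‖α‖)) (fun n => by positivity)
    (fun n => by positivity)).mul_left (C * D)
  refine Summable.of_norm_bounded hsum fun p => ?_
  have hq1 : ‖q‖ ^ (p.1 * p.2) ≤ 1 := pow_le_one₀ (norm_nonneg _) hq.le
  have hu' := hu p.1
  have hv' := hv p.2
  have h0 : 0 ≤ C * r ^ p.1 := by positivity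
  have h1 : 0 ≤ D * s ^ p.2 := (norm_nonneg _).trans hv'
  have h2 := mul_nonneg h0 h1
  rw [norm_mul, norm_mul, norm_mul, norm_pow, norm_pow, add_choose_two_eq]
  calc _ ≤ (C * r ^ p.1) * (D * s ^ p.2) * (‖α‖ ^ (p.1 + p.2) *
        (‖q‖ ^ (p.1.choose 2 + p.2.choose 2) * 1)) := by
        rw [pow_add ‖q‖]
        gcongr
    _ = _ := by
        rw [pow_add, pow_add, mul_pow, mul_pow]
        ring

lemma tsum_tsum_eq_tsum_antidiagonal {F : ℕ × ℕ → ℂ} (hF : Summable F) :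
    ∑' n, ∑' m, F (n, m) = ∑' N, ∑ p ∈ antidiagonal N, F p := by
  rw [← hF.tsum_prod, ← HasAntidiagonal.sigmaAntidiagonalEquivProd.tsum_eq F]
  refine (Summable.tsum_sigma' (fun N => (hasSum_fintype _).summable)
    (HasAntidiagonal.sigmaAntidiagonalEquivProd.summable_iff.2 hF)).trans
    (tsum_congr fun N => ?_)
  rw [tsum_fintype]
  exact Finset.sum_coe_sort (antidiagonal N) F

lemma norm_eulerFactor_le (hq : ‖q‖ < 1) {w : ℕ → ℂ} {C r : ℝ} (hC : 0 ≤ C) (hr : 0 ≤ r)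
    (hw : ∀ n, ‖w n‖ ≤ C * r ^ n) (n : ℕ) :
    ‖w n / qPoch q q n‖ ≤ C * (Real.exp (1 / (1 - ‖q‖)) / ‖qPochInf q q‖) * r ^ n := by
  rw [div_eq_mul_inv, norm_mul, mul_right_comm]
  exact mul_le_mul (hw n) (norm_inv_qPoch_le hq hq n) (norm_nonneg _) (by positivity)

/-- Coefficient of `(a γ x q^m;q)_∞` in the expansion of `(a;q)_∞ J_γ(x;a;q)`. -/
noncomputable def besselDualCoeff (q a g : ℂ) (m : ℕ) : ℂ :=
  qPoch (-g) q m * eulerCoeff q m * (-a) ^ m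

/-- Coefficient of `∏_{j<n} (x + q^j)` in the expansion of `J_γ(x;a;q)`. -/
noncomputable def besselCoeff (q a g : ℂ) (n : ℕ) : ℂ :=
  eulerCoeff q n * (-(a * g)) ^ n / qPoch a q n

lemma bigQBessel_eq_tsum {x : ℂ} (hx : x ≠ 0) (a g : ℂ) :
    bigQBessel q a g x = ∑' n, besselCoeff q a g n * qBinomProd q x 1 n := by
  refine tsum_congr fun n => ?_
  rw [← qPoch_mul_pow_eq_qBinomProd hx, ← Nat.choose_two_right, besselCoeff, eulerCoeff,
    mul_pow (a * g), neg_pow (a * g)]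
  ring

lemma summable_norm_besselCoeff (hq : ‖q‖ < 1) {a : ℂ} (ha : ‖a‖ < 1) (g : ℂ) (r : ℝ) :
    Summable fun n => ‖besselCoeff q a g n‖ * |r| ^ n := by
  refine Summable.of_nonneg_of_le (fun n => by positivity) (fun n => ?_)
    ((summable_norm_eulerCoeff_mul_pow hq (‖a * g‖ * r)).mul_left
      (Real.exp (1 / (1 - ‖q‖)) / ‖qPochInf a q‖))
  rw [besselCoeff, div_eq_mul_inv, norm_mul, norm_mul, norm_pow, norm_neg, abs_mul, abs_norm,
    mul_pow]
  have := norm_inv_qPoch_le hq ha n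
  calc _ = ‖(qPoch a q n)⁻¹‖ * (‖eulerCoeff q n‖ * (‖a * g‖ ^ n * |r| ^ n)) := by ring
    _ ≤ _ := by gcongr

lemma summable_norm_besselDualCoeff (hq : ‖q‖ < 1) (a g : ℂ) (r : ℝ) :
    Summable fun n => ‖besselDualCoeff q a g n‖ * |r| ^ n := by
  refine Summable.of_nonneg_of_le (fun n => by positivity) (fun n => ?_)
    ((summable_norm_eulerCoeff_mul_pow hq (‖a‖ * r)).mul_left
      (Real.exp (‖-g‖ / (1 - ‖q‖))))
  rw [besselDualCoeff, norm_mul, norm_mul, norm_pow, norm_neg, abs_mul, abs_norm, mul_pow]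
  have := norm_qPoch_le hq (le_refl ‖-g‖) n
  calc _ = ‖qPoch (-g) q n‖ * (‖eulerCoeff q n‖ * (‖a‖ ^ n * |r| ^ n)) := by ring
    _ ≤ _ := by gcongr

/-- The transformation `(a;q)_∞ J_γ(x;a;q) =
∑ (-γ;q)_m q^{m(m-1)/2} (-a)^m / (q;q)_m (a γ x q^m;q)_∞`. -/
lemma qPochInf_mul_bigQBessel (hq : ‖q‖ < 1) {a x : ℂ} (ha : ‖a‖ < 1) (hx : x ≠ 0) (g : ℂ) :
    qPochInf a q * bigQBessel q a g x =
      ∑' m, besselDualCoeff q a g m * qPochInf (a * g * x * q ^ m) q := by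
  set u : ℕ → ℂ := fun n => qBinomProd q x 1 n * g ^ n / qPoch q q n with hu
  set v : ℕ → ℂ := fun n => 1 / qPoch q q n with hv
  set u' : ℕ → ℂ := fun n => (g * x) ^ n / qPoch q q n with hu'
  set v' : ℕ → ℂ := fun n => qPoch (-g) q n / qPoch q q n with hv'
  have bu := norm_eulerFactor_le hq (w := fun n => qBinomProd q x 1 n * g ^ n)
    zero_le_one (r := (‖x‖ + 1) * ‖g‖) (by positivity) fun n => by
      rw [norm_mul, norm_pow, mul_pow, one_mul]
      exact mul_le_mul_of_nonneg_right (norm_qBinomProd_le hq le_rfl n) (by positivity)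
  have bv := norm_eulerFactor_le hq (w := fun _ => 1) zero_le_one zero_le_one (by simp)
  have bu' := norm_eulerFactor_le hq (w := fun n => (g * x) ^ n) zero_le_one
    (norm_nonneg (g * x)) (by simp)
  have bv' := norm_eulerFactor_le hq (w := fun n => qPoch (-g) q n)
    (Real.exp_pos (‖-g‖ / (1 - ‖q‖))).le zero_le_one fun n => by
      simpa using norm_qPoch_le hq (le_refl ‖-g‖) n
  have hF := summable_double_choose_two hq (u := u) (v := v) (by positivity) (by positivity)
    zero_le_one bu bv (-a)
  have hG := summable_double_choose_two hq (u := v') (v := u') (by positivity) zero_le_one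
    (norm_nonneg (g * x)) bv' bu' (-a)
  have key := (tsum_tsum_eq_tsum_antidiagonal hF).trans
    (Eq.trans (tsum_congr fun N => ?_) (tsum_tsum_eq_tsum_antidiagonal hG).symm)
  · rw [bigQBessel_eq_tsum hx, ← tsum_mul_left]
    refine Eq.trans (tsum_congr fun n => ?_) (key.trans (tsum_congr fun m => ?_))
    · have h := (hasSum_eulerCoeff hq (a * q ^ n)).tsum_eq
      have h0 := qPoch_ne_zero_of_norm_lt_one hq ha n
      have hc : ∀ X Y Z : ℂ, qPoch a q n * X * (Y / qPoch a q n * Z) = Y * Z * X := by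
        intro X Y Z
        field_simp
      rw [qPochInf_eq_qPoch_mul hq a n, ← h, besselCoeff, hc, ← tsum_mul_left]
      refine tsum_congr fun m => ?_
      simp only [hu, hv]
      rw [add_choose_two_eq, eulerCoeff, eulerCoeff, pow_add q, pow_add q, pow_add (-a),
        ← neg_mul a, ← neg_mul a, mul_pow, mul_pow, pow_mul]
      ring
    · have h := (hasSum_eulerCoeff hq (a * g * x * q ^ m)).tsum_eq
      rw [← h, ← tsum_mul_left]
      refine tsum_congr fun n => ?_
      simp only [hu', hv']
      rw [add_choose_two_eq, besselDualCoeff, eulerCoeff, eulerCoeff, pow_add q, pow_add q,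
        pow_add (-a), show -(a * g * x * q ^ m) = -a * (g * x) * q ^ m by ring,
        mul_pow (-a * (g * x)), mul_pow (-a), pow_mul]
      ring
  · have h := sum_antidiagonal_qBinomProd hq x g N
    have hA : ∀ p ∈ antidiagonal N, u p.1 * v p.2 * ((-a) ^ (p.1 + p.2) *
        q ^ (p.1 + p.2).choose 2) = u p.1 * v p.2 * ((-a) ^ N * q ^ N.choose 2) := fun p hp => by
      rw [mem_antidiagonal.1 hp]
    have hB : ∀ p ∈ antidiagonal N, v' p.1 * u' p.2 * ((-a) ^ (p.1 + p.2) *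
        q ^ (p.1 + p.2).choose 2) = v' p.1 * u' p.2 * ((-a) ^ N * q ^ N.choose 2) := fun p hp => by
      rw [mem_antidiagonal.1 hp]
    rw [sum_congr rfl hA, sum_congr rfl hB, ← sum_mul, ← sum_mul, h,
      ← Nat.sum_antidiagonal_swap]
    simp only [Prod.fst_swap, Prod.snd_swap, mul_comm (v' _)]
    rfl

end Transformation

/-! ### A `q`-beta sum -/

section QBeta

variable {q : ℂ}

/-- The part over the nodes `d q^j` of the `q`-integral over `[c, d]` of
`(q x / c, q x / d;q)_∞ / (β x;q)_∞`, multiplied by `(β c, β d;q)_∞`. -/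
noncomputable def qBetaHalf (q c d β : ℂ) : ℂ :=
  d * qPochInf (β * c) q * ∑' j : ℕ, q ^ j * qPochInf (d / c * q ^ (j + 1)) q *
    qPochInf (q ^ (j + 1)) q * qPoch (β * d) q j

lemma norm_qBetaHalf_term_le (hq : ‖q‖ < 1) (c d : ℂ) {e : ℂ} {r : ℝ} (he : ‖e‖ ≤ r) (j : ℕ) :
    ‖q ^ j * qPochInf (d / c * q ^ (j + 1)) q * qPochInf (q ^ (j + 1)) q * qPoch e q j‖ ≤
      ‖q‖ ^ j * (Real.exp (‖d / c‖ / (1 - ‖q‖)) * Real.exp (1 / (1 - ‖q‖)) *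
        Real.exp (r / (1 - ‖q‖))) := by
  have h0 : ‖q‖ ^ (j + 1) ≤ 1 := pow_le_one₀ (norm_nonneg _) hq.le
  have h1 : ‖qPochInf (d / c * q ^ (j + 1)) q‖ ≤ Real.exp (‖d / c‖ / (1 - ‖q‖)) := by
    refine norm_qPochInf_le hq ?_
    rw [norm_mul, norm_pow]
    exact mul_le_of_le_one_right (norm_nonneg _) h0
  have h2 : ‖qPochInf (q ^ (j + 1)) q‖ ≤ Real.exp (1 / (1 - ‖q‖)) :=
    norm_qPochInf_le hq (by rwa [norm_pow])
  have h3 := norm_qPoch_le hq he j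
  rw [norm_mul, norm_mul, norm_mul, norm_pow, mul_assoc, mul_assoc, mul_assoc (Real.exp _)]
  gcongr

lemma summable_qBetaHalf_term (hq : ‖q‖ < 1) (c d e : ℂ) :
    Summable fun j : ℕ => q ^ j * qPochInf (d / c * q ^ (j + 1)) q *
      qPochInf (q ^ (j + 1)) q * qPoch e q j :=
  Summable.of_norm_bounded ((summable_geometric_of_lt_one (norm_nonneg q) hq).mul_right _)
    (norm_qBetaHalf_term_le hq c d le_rfl)

lemma tendsto_qBetaHalf (hq : ‖q‖ < 1) (c d : ℂ) {u : ℕ → ℂ} (hu : Tendsto u atTop (𝓝 0)) :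
    Tendsto (fun n => qBetaHalf q c d (u n)) atTop (𝓝 (qBetaHalf q c d 0)) := by
  have hm : ∀ e : ℂ, Tendsto (fun n => u n * e) atTop (𝓝 0) := fun e => by
    simpa using hu.mul_const e
  have h1 : qPochInf 0 q = 1 := by simp [qPochInf]
  have h2 : ∀ j, qPoch 0 q j = 1 := by simp [qPoch]
  unfold qBetaHalf
  rw [zero_mul, zero_mul, h1]
  refine ((tendsto_qPochInf_one hq (hm c)).const_mul d).mul ?_
  refine tendsto_tsum_of_dominated_convergence
    ((summable_geometric_of_lt_one (norm_nonneg q) hq).mul_right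
      (Real.exp (‖d / c‖ / (1 - ‖q‖)) * Real.exp (1 / (1 - ‖q‖)) * Real.exp (1 / (1 - ‖q‖))))
    (fun j => ?_) ?_
  · rw [h2]
    exact (tendsto_qPoch_one hq (hm d) j).const_mul _
  · have h3 : ∀ᶠ n in atTop, ‖u n * d‖ < 1 := by
      have := (hm d).norm
      rw [norm_zero] at this
      exact this.eventually_lt_const zero_lt_one
    filter_upwards [h3] with n hn
    exact norm_qBetaHalf_term_le hq c d hn.le

lemma sum_qBetaHalf_telescope (hq : ‖q‖ < 1) {c : ℂ} (hc : c ≠ 0) (d β : ℂ) (N : ℕ) :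
    ∑ j ∈ range (N + 1), d * ((1 - β * c) * (q ^ j * qPochInf (d / c * q ^ (j + 1)) q *
      qPochInf (q ^ (j + 1)) q * qPoch (β * d) q j) - q ^ j * qPochInf (d / c * q ^ (j + 1)) q *
      qPochInf (q ^ (j + 1)) q * qPoch (β * q * d) q j) =
    -(β * c * d) * (qPochInf (d / c * q ^ (N + 1)) q * qPochInf (q ^ (N + 1)) q *
      qPoch (β * q * d) q N) := by
  induction N with
  | zero => simp; ring
  | succ N ih =>
    rw [sum_range_succ, ih, qPochInf_eq_one_sub_mul hq (d / c * q ^ (N + 1)),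
      qPochInf_eq_one_sub_mul hq (q ^ (N + 1)), qPoch_succ', qPoch_succ,
      show d / c * q ^ (N + 1) * q = d / c * q ^ (N + 1 + 1) by ring,
      show q ^ (N + 1) * q = q ^ (N + 1 + 1) by ring, show β * d * q = β * q * d by ring]
    generalize qPochInf (d / c * q ^ (N + 1 + 1)) q = X
    generalize qPochInf (q ^ (N + 1 + 1)) q = Y
    generalize qPoch (β * q * d) q N = Z
    field_simp
    ring

lemma qBetaHalf_sub (hq : ‖q‖ < 1) {c : ℂ} (hc : c ≠ 0) (d β : ℂ) :
    qBetaHalf q c d β - qBetaHalf q c d (β * q) =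
      -(β * c * d) * qPochInf (β * q * c) q * qPochInf (β * q * d) q := by
  have s1 := summable_qBetaHalf_term hq c d (β * d)
  have s2 := summable_qBetaHalf_term hq c d (β * q * d)
  have h1 := (((s1.hasSum.mul_left (1 - β * c)).sub s2.hasSum).mul_left d).tendsto_sum_nat
  have h2 := (tendsto_add_atTop_iff_nat 1).2 h1
  simp only [sum_qBetaHalf_telescope hq hc] at h2
  have hq' : Tendsto (fun N : ℕ => q ^ (N + 1)) atTop (𝓝 0) :=
    (tendsto_add_atTop_iff_nat 1).2 (tendsto_pow_atTop_nhds_zero_of_norm_lt_one hq)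
  have hq'' : Tendsto (fun N : ℕ => d / c * q ^ (N + 1)) atTop (𝓝 0) := by
    simpa using hq'.const_mul (d / c)
  have h3 := ((((tendsto_qPochInf_one hq hq'').mul (tendsto_qPochInf_one hq hq')).mul
    (tendsto_qPoch hq (β * q * d))).const_mul (-(β * c * d)))
  have h4 := tendsto_nhds_unique h2 h3
  rw [qBetaHalf, qBetaHalf, qPochInf_eq_one_sub_mul hq (β * c),
    show β * c * q = β * q * c by ring]
  linear_combination qPochInf (β * q * c) q * h4

/-- The `q`-beta sum. -/
lemma qBetaHalf_sub_swap (hq : ‖q‖ < 1) {c d : ℂ} (hc : c ≠ 0) (hd : d ≠ 0) (β : ℂ) :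
    qBetaHalf q c d β - qBetaHalf q d c β = d * qPochInf q q * qTheta q (c / d) := by
  set G : ℂ → ℂ := fun β => qBetaHalf q c d β - qBetaHalf q d c β with hG
  have hstep : ∀ β, G β = G (β * q) := fun β => by
    have h1 := qBetaHalf_sub hq hc d β
    have h2 := qBetaHalf_sub hq hd c β
    simp only [hG]
    linear_combination h1 - h2
  have hiter : ∀ β, ∀ n : ℕ, G β = G (β * q ^ n) := by
    intro β n
    induction n with
    | zero => simp
    | succ n ih => rw [ih, hstep, mul_assoc, ← pow_succ]
  have hzero : ∀ β, G β = G 0 := fun β => by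
    have h := (tendsto_qBetaHalf hq c d (tendsto_mul_pow_zero hq β)).sub
      (tendsto_qBetaHalf hq d c (tendsto_mul_pow_zero hq β))
    change Tendsto (fun n : ℕ => G (β * q ^ n)) atTop (𝓝 (G 0)) at h
    simp only [← hiter] at h
    exact tendsto_nhds_unique tendsto_const_nhds h
  have h1 : qBetaHalf q c d (q / c) = d * qPochInf q q * qPochInf (q * d / c) q := by
    have h := (hasSum_mul_qPochInf hq 1).tsum_eq
    rw [qPochInf_eq_zero hq (x := 1) (n := 0) (by simp), sub_zero] at h
    rw [qBetaHalf, div_mul_cancel₀ _ hc]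
    have : ∀ j : ℕ, q ^ j * qPochInf (d / c * q ^ (j + 1)) q * qPochInf (q ^ (j + 1)) q *
        qPoch (q / c * d) q j = qPochInf (q * d / c) q *
          (1 * q ^ j * qPochInf (1 * q ^ (j + 1)) q) := fun j => by
      rw [qPochInf_eq_qPoch_mul hq (q * d / c) j, one_mul, one_mul,
        show q * d / c * q ^ j = d / c * q ^ (j + 1) by ring, show q / c * d = q * d / c by ring]
      ring
    rw [tsum_congr this, tsum_mul_left, h, mul_one]
  have h2 : qBetaHalf q d c (q / c) =
      d * qPochInf q q * qPochInf (q * d / c) q * (1 - qPochInf (c / d) q) := by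
    rw [← (hasSum_mul_qPochInf hq (c / d)).tsum_eq, qBetaHalf, div_mul_cancel₀ _ hc,
      ← tsum_mul_left, ← tsum_mul_left]
    refine tsum_congr fun j => ?_
    rw [qPochInf_eq_qPoch_mul hq q j, show q / c * d = q * d / c by ring,
      show q * q ^ j = q ^ (j + 1) by ring]
    field_simp
  have h3 := (hzero β).trans (hzero (q / c)).symm
  simp only [hG] at h3
  rw [h3, h1, h2, qTheta, show q / (c / d) = q * d / c by field_simp]
  ring

end QBeta

/-! ### The orthogonality measure and its nodes -/

section Measure

variable {q a g : ℂ}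

/-- The nodes of the orthogonality measure. -/
noncomputable def besselNode (q a g : ℂ) : ℕ ⊕ ℤ → ℂ :=
  Sum.elim (fun j => -q ^ j) (fun j => q / (a * g) * q ^ j)

/-- The point masses of the orthogonality measure. -/
noncomputable def besselMass (q a g : ℂ) : ℕ ⊕ ℤ → ℂ :=
  Sum.elim (fun j => q ^ j * bigQWeight q a (-q ^ j))
    (fun j => q / (a * g) * q ^ j * bigQWeight q a (q / (a * g) * q ^ j))

/-- The factor `(a γ q^m x;q)_∞`. -/
noncomputable def besselKernel (q a g : ℂ) (m : ℤ) (x : ℂ) : ℂ := qPochInf (a * g * q ^ m * x) q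

lemma besselNode_ne_zero (hq0 : q ≠ 0) (ha : a ≠ 0) (hg : g ≠ 0) (i : ℕ ⊕ ℤ) :
    besselNode q a g i ≠ 0 := by
  rcases i with j | j
  · exact neg_ne_zero.2 (pow_ne_zero j hq0)
  · exact mul_ne_zero (div_ne_zero hq0 (mul_ne_zero ha hg)) (zpow_ne_zero j hq0)

lemma qPochInf_zpow_eq_zero (hq : ‖q‖ < 1) (hq0 : q ≠ 0) {s : ℤ} (hs : s ≤ 0) :
    qPochInf (q ^ s) q = 0 := by
  obtain ⟨n, hn⟩ := Int.eq_ofNat_of_zero_le (neg_nonneg.2 hs)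
  refine qPochInf_eq_zero hq (n := n) ?_
  rw [← zpow_natCast, ← zpow_add₀ hq0, ← hn]
  simp

lemma besselKernel_inr (hq0 : q ≠ 0) (ha : a ≠ 0) (hg : g ≠ 0) (m j : ℤ) :
    besselKernel q a g m (besselNode q a g (Sum.inr j)) = qPochInf (q ^ (1 + m + j)) q := by
  rw [besselKernel, besselNode, Sum.elim_inr, zpow_add₀ hq0, zpow_add₀ hq0, zpow_one]
  congr 1
  field_simp

lemma besselKernel_inr_eq_zero (hq : ‖q‖ < 1) (hq0 : q ≠ 0) (ha : a ≠ 0) (hg : g ≠ 0) {m j : ℤ}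
    (h : m + j < 0) : besselKernel q a g m (besselNode q a g (Sum.inr j)) = 0 := by
  rw [besselKernel_inr hq0 ha hg, qPochInf_zpow_eq_zero hq hq0 (by omega)]

lemma norm_besselKernel_inr_le (hq : ‖q‖ < 1) (hq0 : q ≠ 0) (ha : a ≠ 0) (hg : g ≠ 0) (m j : ℤ) :
    ‖besselKernel q a g m (besselNode q a g (Sum.inr j))‖ ≤ Real.exp (1 / (1 - ‖q‖)) := by
  rcases lt_or_ge (m + j) 0 with h | h
  · rw [besselKernel_inr_eq_zero hq hq0 ha hg h, norm_zero]
    positivity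
  · rw [besselKernel_inr hq0 ha hg]
    refine norm_qPochInf_le hq ?_
    obtain ⟨n, hn⟩ := Int.eq_ofNat_of_zero_le (show 0 ≤ 1 + m + j by omega)
    rw [hn, norm_zpow]
    exact_mod_cast pow_le_one₀ (norm_nonneg _) hq.le

lemma norm_besselKernel_inr_le_zpow (hq : ‖q‖ < 1) (hq0 : q ≠ 0) (ha : a ≠ 0) (hg : g ≠ 0)
    {T : ℝ} (hT : 1 ≤ T) (m j : ℤ) :
    ‖besselKernel q a g m (besselNode q a g (Sum.inr j))‖ ≤
      Real.exp (1 / (1 - ‖q‖)) * T ^ (m + j) := by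
  rcases lt_or_ge (m + j) 0 with h | h
  · rw [besselKernel_inr_eq_zero hq hq0 ha hg h, norm_zero]
    positivity
  · exact (norm_besselKernel_inr_le hq hq0 ha hg m j).trans
      (le_mul_of_one_le_right (by positivity) (one_le_zpow₀ hT h))

lemma norm_besselKernel_le (hq : ‖q‖ < 1) (hq0 : q ≠ 0) (ha : a ≠ 0) (hg : g ≠ 0) (m : ℤ)
    (n : ℕ) (i : ℕ ⊕ ℤ) :
    ‖besselKernel q a g (m + n) (besselNode q a g i)‖ ≤
      Real.exp ((1 + ‖a * g * q ^ m‖) / (1 - ‖q‖)) := by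
  have hq1 : 0 ≤ 1 - ‖q‖ := sub_nonneg.2 hq.le
  rcases i with j | j
  · refine norm_qPochInf_le hq ?_
    rw [besselNode, Sum.elim_inl, zpow_add₀ hq0, zpow_natCast, ← mul_assoc, mul_neg, norm_neg,
      mul_assoc _ (q ^ n), ← pow_add, norm_mul, norm_pow]
    have := mul_le_of_le_one_right (norm_nonneg (a * g * q ^ m))
      (pow_le_one₀ (n := n + j) (norm_nonneg _) hq.le)
    linarith
  · refine (norm_besselKernel_inr_le hq hq0 ha hg _ j).trans (Real.exp_le_exp.2 ?_)
    refine div_le_div_of_nonneg_right ?_ hq1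
    linarith [norm_nonneg (a * g * q ^ m)]

lemma qPochInf_mul_bigQBessel_node (hq : ‖q‖ < 1) (hq0 : q ≠ 0) (ha : a ≠ 0) (ha1 : ‖a‖ < 1)
    (hg : g ≠ 0) (k : ℤ) (i : ℕ ⊕ ℤ) :
    qPochInf a q * bigQBessel q a (g * q ^ k) (besselNode q a g i) =
      ∑' m : ℕ, besselDualCoeff q a (g * q ^ k) m *
        besselKernel q a g (k + m) (besselNode q a g i) := by
  rw [qPochInf_mul_bigQBessel hq ha1 (besselNode_ne_zero hq0 ha hg i)]
  refine tsum_congr fun m => ?_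
  rw [besselKernel, zpow_add₀ hq0, zpow_natCast]
  congr 2
  ring

lemma norm_tsum_besselDualCoeff_le (hq : ‖q‖ < 1) {G : ℂ} {T : ℝ} (hT : 1 ≤ T) {K : ℕ → ℂ}
    {M : ℝ} (hK : ∀ m, ‖K m‖ ≤ M * T ^ m) :
    ‖∑' m, besselDualCoeff q a G m * K m‖ ≤ M * ∑' m, ‖besselDualCoeff q a G m‖ * T ^ m := by
  have hs := summable_norm_besselDualCoeff hq a G T
  rw [abs_of_nonneg (zero_le_one.trans hT)] at hs
  refine tsum_of_norm_bounded (hs.hasSum.mul_left M) fun m => ?_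
  rw [norm_mul, mul_left_comm]
  exact mul_le_mul_of_nonneg_left (hK m) (norm_nonneg _)

/-- Bounds for the big `q`-Bessel function on the nodes, uniform and decaying at infinity. -/
lemma exists_norm_bigQBessel_node_le (hq : ‖q‖ < 1) (hq0 : q ≠ 0) (ha : a ≠ 0) (ha1 : ‖a‖ < 1)
    (hg : g ≠ 0) (k : ℤ) {T : ℝ} (hT : 1 ≤ T) :
    ∃ C : ℝ, (∀ i, ‖bigQBessel q a (g * q ^ k) (besselNode q a g i)‖ ≤ C) ∧
      ∀ j : ℤ, ‖bigQBessel q a (g * q ^ k) (besselNode q a g (Sum.inr j))‖ ≤ C * T ^ j := by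
  have hA : 0 < ‖qPochInf a q‖ := norm_pos_iff.2 (qPochInf_ne_zero_of_norm_lt_one hq ha1)
  have hT0 : 0 < T := zero_lt_one.trans_le hT
  set D : ℝ := ∑' m, ‖besselDualCoeff q a (g * q ^ k) m‖ * T ^ m with hD
  have hD0 : 0 ≤ D := tsum_nonneg fun m => by positivity
  set M₁ : ℝ := Real.exp ((1 + ‖a * g * q ^ k‖) / (1 - ‖q‖)) with hM₁
  set M₂ : ℝ := Real.exp (1 / (1 - ‖q‖)) * T ^ k with hM₂
  have hM₁0 : 0 < M₁ := Real.exp_pos _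
  have hM₂0 : 0 < M₂ := by positivity
  refine ⟨(M₁ + M₂) * D / ‖qPochInf a q‖, fun i => ?_, fun j => ?_⟩
  · rw [le_div_iff₀ hA, mul_comm, ← norm_mul, qPochInf_mul_bigQBessel_node hq hq0 ha ha1 hg]
    refine (norm_tsum_besselDualCoeff_le hq hT (M := M₁) fun m => ?_).trans ?_
    · exact (norm_besselKernel_le hq hq0 ha hg k m i).trans
        (le_mul_of_one_le_right hM₁0.le (one_le_pow₀ hT))
    · exact mul_le_mul_of_nonneg_right (by linarith) hD0
  · rw [div_mul_eq_mul_div, le_div_iff₀ hA, mul_comm, ← norm_mul,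
      qPochInf_mul_bigQBessel_node hq hq0 ha ha1 hg]
    refine (norm_tsum_besselDualCoeff_le hq hT (M := M₂ * T ^ j) fun m => ?_).trans ?_
    · refine (norm_besselKernel_inr_le_zpow hq hq0 ha hg hT (k + m) j).trans_eq ?_
      rw [hM₂, zpow_add₀ hT0.ne', zpow_add₀ hT0.ne', zpow_natCast]
      ring
    · have : 0 ≤ M₁ * D * T ^ j := by positivity
      nlinarith

lemma inv_qPochInf_mul_pow (hq : ‖q‖ < 1) {y : ℂ} (hy : qPochInf y q ≠ 0) (i : ℕ) :
    (qPochInf (y * q ^ i) q)⁻¹ = qPoch y q i / qPochInf y q := by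
  have h1 := qPochInf_eq_qPoch_mul hq y i
  have h2 : qPochInf (y * q ^ i) q ≠ 0 := fun h => hy (by rw [h1, h, mul_zero])
  rw [eq_div_iff hy, h1]
  field_simp

lemma norm_inv_qPochInf_mul_pow_le (hq : ‖q‖ < 1) {y : ℂ} (hy : qPochInf y q ≠ 0) (j : ℕ) :
    ‖(qPochInf (y * q ^ j) q)⁻¹‖ ≤ Real.exp (‖y‖ / (1 - ‖q‖)) / ‖qPochInf y q‖ := by
  rw [inv_qPochInf_mul_pow hq hy, norm_div]
  exact div_le_div_of_nonneg_right (norm_qPoch_le hq le_rfl j) (norm_nonneg _)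

lemma exists_norm_bigQWeight_le (hq : ‖q‖ < 1) {x : ℂ} (hx : qPochInf (-(a * x)) q ≠ 0) :
    ∃ W : ℝ, ∀ j : ℕ, ‖bigQWeight q a (x * q ^ j)‖ ≤ W := by
  refine ⟨Real.exp (‖q * x‖ / (1 - ‖q‖)) *
    (Real.exp (‖-(a * x)‖ / (1 - ‖q‖)) / ‖qPochInf (-(a * x)) q‖), fun j => ?_⟩
  rw [bigQWeight, div_eq_mul_inv, norm_mul, show -(a * (x * q ^ j)) = -(a * x) * q ^ j by ring]
  refine mul_le_mul (norm_qPochInf_le hq ?_) (norm_inv_qPochInf_mul_pow_le hq hx j)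
    (norm_nonneg _) (Real.exp_pos _).le
  rw [norm_neg, ← mul_assoc, norm_mul _ (q ^ j), norm_pow]
  exact mul_le_of_le_one_right (norm_nonneg _) (pow_le_one₀ (norm_nonneg _) hq.le)

lemma bigQWeight_eq (hq : ‖q‖ < 1) (x : ℂ) :
    bigQWeight q a x = (1 + q * x) / (1 + a * x) * bigQWeight q a (x * q) := by
  rw [bigQWeight, bigQWeight, qPochInf_eq_one_sub_mul hq (-(q * x)),
    qPochInf_eq_one_sub_mul hq (-(a * x)), div_mul_div_comm]
  congr 2 <;> ring_nf

end Measure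

section Positivity

variable {q a γ : ℝ}

lemma qPochInf_neg_ofReal_ne_zero (hq0 : 0 < q) (hq1 : q < 1) {x : ℝ} (hx : 0 < x) :
    qPochInf (-(x : ℂ)) (q : ℂ) ≠ 0 := by
  refine qPochInf_ne_zero (by simpa [abs_of_pos hq0] using hq1) fun n h => ?_
  have h1 : -x * q ^ n = 1 := by exact_mod_cast h
  have h2 : 0 < x * q ^ n := by positivity
  linarith

lemma exists_norm_bigQWeight_zpow_neg_le (hq0 : 0 < q) (hq1 : q < 1) (ha0 : 0 < a)
    {x : ℝ} (hx : 0 < x) :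
    ∃ W : ℝ, ∀ j : ℕ, ‖bigQWeight (q : ℂ) a (x * (q : ℂ) ^ (-(j : ℤ)))‖ ≤ W * (1 + q / a) ^ j := by
  refine ⟨‖bigQWeight (q : ℂ) a x‖, fun j => ?_⟩
  have hqc : ‖(q : ℂ)‖ < 1 := by simpa [abs_of_pos hq0] using hq1
  have hq' : (q : ℂ) ≠ 0 := by exact_mod_cast hq0.ne'
  induction j with
  | zero => simp
  | succ j ih =>
    have hs : (x : ℂ) * (q : ℂ) ^ (-((j + 1 : ℕ) : ℤ)) * q = x * (q : ℂ) ^ (-(j : ℤ)) := by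
      rw [mul_assoc, ← zpow_add_one₀ hq']
      congr 2
      push_cast
      ring
    rw [bigQWeight_eq hqc, hs, norm_mul]
    refine (mul_le_mul ?_ ih (norm_nonneg _) (by positivity : (0 : ℝ) ≤ 1 + q / a)).trans_eq
      (by ring)
    set y : ℝ := x * q ^ (-((j + 1 : ℕ) : ℤ)) with hy
    have hy0 : 0 < y := by positivity
    have hyc : (x : ℂ) * (q : ℂ) ^ (-((j + 1 : ℕ) : ℤ)) = (y : ℂ) := by
      rw [hy]
      push_cast
      rfl
    have : (1 + q * (y : ℂ)) / (1 + a * (y : ℂ)) = (((1 + q * y) / (1 + a * y) : ℝ) : ℂ) := by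
      push_cast
      rfl
    rw [hyc, this, Complex.norm_real, Real.norm_of_nonneg (by positivity),
      div_le_iff₀ (by positivity)]
    have : (1 + q / a) * (1 + a * y) = 1 + q * y + a * y + q / a := by
      field_simp
      ring
    rw [this]
    have : 0 < a * y + q / a := by positivity
    linarith

/-- Boundedness together with fast enough decay at infinity gives summability against the
orthogonality measure. -/
lemma exists_summable_besselMass_mul (hq0 : 0 < q) (hq1 : q < 1) (ha0 : 0 < a) (ha1 : a < 1)
    (hγ : 0 < γ) :
    ∃ T : ℝ, 1 ≤ T ∧ ∀ (f : ℕ ⊕ ℤ → ℂ) (C : ℝ), (∀ i, ‖f i‖ ≤ C) →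
      (∀ j : ℤ, ‖f (Sum.inr j)‖ ≤ C * T ^ j) →
      Summable fun i => besselMass (q : ℂ) a γ i * f i := by
  have hqc : ‖(q : ℂ)‖ < 1 := by simpa [abs_of_pos hq0] using hq1
  have hqn : ‖(q : ℂ)‖ = q := by simp [abs_of_pos hq0]
  have hgeom := summable_geometric_of_lt_one hq0.le hq1
  set ζ : ℝ := q / (a * γ) with hζ
  have hζ0 : 0 < ζ := by positivity
  have hζc : (q : ℂ) / (a * γ) = (ζ : ℂ) := by
    rw [hζ]
    push_cast
    rfl
  obtain ⟨W₁, hW₁⟩ := exists_norm_bigQWeight_le (q := (q : ℂ)) (a := (a : ℂ)) (x := -1) hqc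
    (qPochInf_ne_zero_of_norm_lt_one hqc (by simpa [abs_of_pos ha0] using ha1))
  obtain ⟨W₂, hW₂⟩ := exists_norm_bigQWeight_le (q := (q : ℂ)) (a := (a : ℂ)) (x := ζ) hqc
    (by exact_mod_cast qPochInf_neg_ofReal_ne_zero hq0 hq1 (mul_pos ha0 hζ0))
  obtain ⟨W₃, hW₃⟩ := exists_norm_bigQWeight_zpow_neg_le hq0 hq1 ha0 hζ0
  have hW₁0 := (norm_nonneg _).trans (hW₁ 0)
  have hW₂0 := (norm_nonneg _).trans (hW₂ 0)
  have hW₃0 : 0 ≤ W₃ := by simpa using (norm_nonneg _).trans (hW₃ 0)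
  set R : ℝ := 1 + q / a with hR
  have hR1 : 1 ≤ R := by
    have : 0 < q / a := by positivity
    linarith
  have hR0 : 0 < R := zero_lt_one.trans_le hR1
  refine ⟨2 * R / q, ?_, fun f C hC hC' => ?_⟩
  · rw [le_div_iff₀ hq0]
    linarith
  have hC0 := (norm_nonneg _).trans (hC (Sum.inl 0))
  suffices h : Summable (fun j : ℕ => besselMass (q : ℂ) a γ (Sum.inl j) * f (Sum.inl j)) ∧
      Summable (fun j : ℤ => besselMass (q : ℂ) a γ (Sum.inr j) * f (Sum.inr j)) from
    (h.1.hasSum.sum (f := fun i => besselMass (q : ℂ) a γ i * f i) h.2.hasSum).summable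
  constructor
  · refine Summable.of_norm_bounded (hgeom.mul_right (W₁ * C)) fun j => ?_
    have h1 := hW₁ j
    rw [neg_one_mul] at h1
    rw [besselMass, Sum.elim_inl, norm_mul, norm_mul, norm_pow, hqn, mul_assoc]
    gcongr
    exact hC _
  · refine Summable.of_nat_of_neg_add_one ?_ ?_
    · refine Summable.of_norm_bounded (hgeom.mul_right (ζ * W₂ * C)) fun j => ?_
      have h1 := hW₂ j
      rw [besselMass, Sum.elim_inr, hζc, norm_mul, norm_mul, norm_mul, zpow_natCast, norm_pow, hqn,
        Complex.norm_real, Real.norm_of_nonneg hζ0.le]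
      calc _ ≤ ζ * q ^ j * W₂ * C := by
            gcongr
            exact hC _
        _ = _ := by ring
    · refine Summable.of_norm_bounded ((summable_geometric_two.comp_injective
        (add_left_injective 1)).mul_left (ζ * W₃ * C)) fun j => ?_
      have h1 := hW₃ (j + 1)
      have h2 := hC' (-((j : ℤ) + 1))
      have e : -((j : ℤ) + 1) = -((j + 1 : ℕ) : ℤ) := by push_cast; ring
      rw [e] at h2 ⊢
      rw [besselMass, Sum.elim_inr, hζc, norm_mul, norm_mul, norm_mul, norm_zpow, hqn,
        Complex.norm_real, Real.norm_of_nonneg hζ0.le]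
      calc _ ≤ ζ * q ^ (-((j + 1 : ℕ) : ℤ)) * (W₃ * R ^ (j + 1)) *
            (C * (2 * R / q) ^ (-((j + 1 : ℕ) : ℤ))) := by gcongr
        _ = _ := by
          simp only [zpow_neg, zpow_natCast, Function.comp_apply]
          rw [div_pow, mul_pow, div_pow, one_pow]
          field_simp

end Positivity

/-! ### Integrating the kernel against the orthogonality measure -/

section Moments

variable {q a g : ℂ}

lemma qBinomProd_mul_qPochInf (hq : ‖q‖ < 1) (y : ℂ) (n : ℕ) :
    qBinomProd q (-(q ^ n * y)) 1 n * qPochInf (q ^ (n + 1) * y) q =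
      q ^ n.choose 2 * qPochInf (q * y) q := by
  have h : qBinomProd q (-(q ^ n * y)) 1 n = q ^ n.choose 2 * qPoch (q * y) q n := by
    rw [qBinomProd, ← prod_range_reflect, qPoch, Nat.choose_two_right, ← sum_range_id,
      ← sum_range_reflect, ← prod_pow_eq_pow_sum, ← prod_mul_distrib]
    refine prod_congr rfl fun j hj => ?_
    have hn : n = (n - 1 - j) + (j + 1) := by have := mem_range.1 hj; omega
    have e : q ^ n = q ^ (n - 1 - j) * q ^ (j + 1) := by rw [← pow_add, ← hn]
    rw [e]
    ring
  rw [h, qPochInf_eq_qPoch_mul hq (q * y) n]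
  ring_nf

lemma qBinomProd_neg_pow_eq_zero {j n : ℕ} (h : j < n) : qBinomProd q (-q ^ j) 1 n = 0 :=
  prod_eq_zero (mem_range.2 h) (by ring)

lemma hasSum_besselMass_inl (hq : ‖q‖ < 1) (hq0 : q ≠ 0) (ha : a ≠ 0) (hg : g ≠ 0) (m : ℤ)
    (n : ℕ) {c d : ℂ} (hc : c = -q ^ n) (hd : d = q / (a * g) * q ^ (-m))
    (h1 : qPochInf (-a * c) q ≠ 0) (h2 : qPochInf (-a * d) q ≠ 0) :
    HasSum (fun j : ℕ => besselMass q a g (Sum.inl j) *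
        besselKernel q a g m (besselNode q a g (Sum.inl j)) *
        qBinomProd q (besselNode q a g (Sum.inl j)) 1 n)
      (-(q ^ n.choose 2 / (qPochInf (-a * c) q * qPochInf (-a * d) q)) *
        qBetaHalf q d c (-a)) := by
  refine ((add_left_injective n).hasSum_iff fun j hj => ?_).1 ?_
  · have hjn : j < n := by
      by_contra! h
      exact hj ⟨j - n, Nat.sub_add_cancel h⟩
    simp only [besselNode, Sum.elim_inl, qBinomProd_neg_pow_eq_zero hjn, mul_zero]
  · have hs := (summable_qBetaHalf_term hq d c (-a * c)).hasSum.mul_left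
      (-(q ^ n.choose 2 / qPochInf (-a * c) q) * c)
    refine (congrArg₂ (fun f s => HasSum f s) (funext fun i => ?_) ?_).mpr hs
    · have hm : q ^ m ≠ 0 := zpow_ne_zero m hq0
      have hk : a * g * q ^ m * (-q ^ (i + n)) = c / d * q ^ (i + 1) := by
        rw [hc, hd, zpow_neg]
        field_simp
        ring
      have hp := qBinomProd_mul_qPochInf hq (q ^ i) n
      have hw : -(a * -q ^ (i + n)) = -a * c * q ^ i := by rw [hc]; ring
      simp only [Function.comp_apply, besselMass, besselKernel, besselNode, Sum.elim_inl,
        bigQWeight, hk, hw]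
      rw [div_eq_mul_inv, inv_qPochInf_mul_pow hq h1,
        show -(q * -q ^ (i + n)) = q ^ (n + 1) * q ^ i by ring,
        show -q ^ (i + n) = -(q ^ n * q ^ i) by ring,
        show q ^ (i + 1) = q * q ^ i by ring, pow_add]
      rw [hc] at *
      linear_combination (q ^ i * q ^ n * (qPoch (-a * -q ^ n) q i / qPochInf (-a * -q ^ n) q) *
        qPochInf (-q ^ n / d * (q * q ^ i)) q) * hp
    · rw [qBetaHalf]
      generalize qPochInf (-a * d) q = B at h2
      field_simp

lemma hasSum_besselMass_inr (hq : ‖q‖ < 1) (hq0 : q ≠ 0) (ha : a ≠ 0) (hg : g ≠ 0) (m : ℤ)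
    (n : ℕ) {c d : ℂ} (hc : c = -q ^ n) (hd : d = q / (a * g) * q ^ (-m))
    (h1 : qPochInf (-a * c) q ≠ 0) (h2 : qPochInf (-a * d) q ≠ 0) :
    HasSum (fun j : ℤ => besselMass q a g (Sum.inr j) *
        besselKernel q a g m (besselNode q a g (Sum.inr j)) *
        qBinomProd q (besselNode q a g (Sum.inr j)) 1 n)
      (q ^ n.choose 2 / (qPochInf (-a * c) q * qPochInf (-a * d) q) *
        qBetaHalf q c d (-a)) := by
  have hinj : Function.Injective fun i : ℕ => (i : ℤ) - m := fun i j h => by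
    simpa using h
  refine (hinj.hasSum_iff fun j hj => ?_).1 ?_
  · have hjm : m + j < 0 := by
      by_contra! h
      exact hj ⟨(m + j).toNat, by simp [Int.toNat_of_nonneg h]⟩
    rw [besselKernel_inr_eq_zero hq hq0 ha hg hjm]
    ring
  · have hs := (summable_qBetaHalf_term hq c d (-a * d)).hasSum.mul_left
      (q ^ n.choose 2 / qPochInf (-a * d) q * d)
    refine (congrArg₂ (fun f s => HasSum f s) (funext fun i => ?_) ?_).mpr hs
    · have hx : q / (a * g) * q ^ ((i : ℤ) - m) = d * q ^ i := by
        rw [hd, sub_eq_neg_add, zpow_add₀ hq0, zpow_natCast]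
        ring
      have hn : q ^ n ≠ 0 := pow_ne_zero n hq0
      have hp := qBinomProd_mul_qPochInf hq (d / c * q ^ i) n
      have hx' : -(q ^ n * (d / c * q ^ i)) = d * q ^ i := by
        rw [hc]
        field_simp
      have hx'' : q ^ (n + 1) * (d / c * q ^ i) = -(q * (d * q ^ i)) := by
        rw [← hx']
        ring
      rw [hx', hx''] at hp
      simp only [Function.comp_apply]
      rw [besselKernel_inr hq0 ha hg,
        show 1 + m + ((i : ℤ) - m) = ((i + 1 : ℕ) : ℤ) by push_cast; ring, zpow_natCast]
      simp only [besselMass, besselNode, Sum.elim_inr, bigQWeight, hx]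
      rw [show -(a * (d * q ^ i)) = -a * d * q ^ i by ring, div_eq_mul_inv,
        inv_qPochInf_mul_pow hq h2, show d / c * q ^ (i + 1) = q * (d / c * q ^ i) by ring]
      linear_combination (d * q ^ i * (qPoch (-a * d) q i / qPochInf (-a * d) q) *
        qPochInf (q ^ (i + 1)) q) * hp
    · rw [qBetaHalf]
      generalize qPochInf (-a * c) q = B at h1
      field_simp

/-- The moments of `(a γ q^m x;q)_∞` against the basis `∏_{j<n} (x + q^j)`. -/
lemma tsum_besselMass_mul_besselKernel_mul_qBinomProd (hq : ‖q‖ < 1) (hq0 : q ≠ 0) (ha : a ≠ 0)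
    (hg : g ≠ 0) (m : ℤ) (n : ℕ) {d : ℂ} (hd : d = q / (a * g) * q ^ (-m))
    (h1 : qPochInf (a * q ^ n) q ≠ 0) (h2 : qPochInf (-a * d) q ≠ 0) :
    ∑' i, besselMass q a g i * besselKernel q a g m (besselNode q a g i) *
        qBinomProd q (besselNode q a g i) 1 n =
      q ^ n.choose 2 * d * qPochInf q q * qTheta q (-q ^ n / d) /
        (qPochInf (a * q ^ n) q * qPochInf (-a * d) q) := by
  have hd0 : d ≠ 0 := by
    rw [hd]
    exact mul_ne_zero (div_ne_zero hq0 (mul_ne_zero ha hg)) (zpow_ne_zero _ hq0)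
  have hc0 : -q ^ n ≠ 0 := neg_ne_zero.2 (pow_ne_zero n hq0)
  have e : a * q ^ n = -a * -q ^ n := by ring
  rw [e] at h1 ⊢
  rw [((hasSum_besselMass_inl hq hq0 ha hg m n rfl hd h1 h2).sum
    (f := fun i => besselMass q a g i * besselKernel q a g m (besselNode q a g i) *
      qBinomProd q (besselNode q a g i) 1 n)
    (hasSum_besselMass_inr hq hq0 ha hg m n rfl hd h1 h2)).tsum_eq]
  have h := qBetaHalf_sub_swap hq hc0 hd0 (-a)
  linear_combination q ^ n.choose 2 / (qPochInf (-a * -q ^ n) q * qPochInf (-a * d) q) * h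

lemma exists_norm_besselKernel_node_le (hq : ‖q‖ < 1) (hq0 : q ≠ 0) (ha : a ≠ 0)
    (hg : g ≠ 0) (m : ℤ) {T : ℝ} (hT : 1 ≤ T) :
    ∃ C : ℝ, (∀ i, ‖besselKernel q a g m (besselNode q a g i)‖ ≤ C) ∧
      ∀ j : ℤ, ‖besselKernel q a g m (besselNode q a g (Sum.inr j))‖ ≤ C * T ^ j := by
  have hT0 : 0 < T := zero_lt_one.trans_le hT
  set M : ℝ := Real.exp ((1 + ‖a * g * q ^ m‖) / (1 - ‖q‖))
  have hM : 0 < M := Real.exp_pos _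
  refine ⟨M + Real.exp (1 / (1 - ‖q‖)) * T ^ m, fun i => ?_, fun j => ?_⟩
  · have h := norm_besselKernel_le hq hq0 ha hg m 0 i
    rw [Nat.cast_zero, add_zero] at h
    exact h.trans (le_add_of_nonneg_right (by positivity))
  · have h := norm_besselKernel_inr_le_zpow hq hq0 ha hg hT m j
    rw [zpow_add₀ hT0.ne', ← mul_assoc] at h
    refine h.trans (mul_le_mul_of_nonneg_right ?_ (by positivity))
    exact le_add_of_nonneg_left hM.le

lemma norm_besselKernel_mul_qBinomProd_le (hq : ‖q‖ < 1) (hq0 : q ≠ 0) (ha : a ≠ 0)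
    (hg : g ≠ 0) (m : ℤ) (n : ℕ) (i : ℕ ⊕ ℤ) :
    ‖besselKernel q a g m (besselNode q a g i) * qBinomProd q (besselNode q a g i) 1 n‖ ≤
      ‖besselKernel q a g m (besselNode q a g i)‖ * (1 + ‖q / (a * g)‖ * ‖q ^ (-m)‖ + 1) ^ n := by
  rw [norm_mul]
  rcases i with j | j
  · refine mul_le_mul_of_nonneg_left (norm_qBinomProd_le hq ?_ n) (norm_nonneg _)
    rw [besselNode, Sum.elim_inl, norm_neg, norm_pow]
    exact (pow_le_one₀ (norm_nonneg _) hq.le).trans (le_add_of_nonneg_right (by positivity))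
  · rcases lt_or_ge (m + j) 0 with h | h
    · simp [besselKernel_inr_eq_zero hq hq0 ha hg h]
    · refine mul_le_mul_of_nonneg_left (norm_qBinomProd_le hq ?_ n) (norm_nonneg _)
      rw [besselNode, Sum.elim_inr, norm_mul]
      refine le_add_of_nonneg_of_le zero_le_one (mul_le_mul_of_nonneg_left ?_ (norm_nonneg _))
      rw [norm_zpow, norm_zpow]
      exact zpow_le_zpow_right_of_le_one₀ (norm_pos_iff.2 hq0) hq.le (by omega)

end Moments

/-! ### Theta functions and orthogonality -/

lemma summable_and_tsum_comm_of_norm_le {ι : Type*} {F : ι → ℕ → ℂ} {b : ι → ℝ} {c : ℕ → ℝ}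
    (hb : Summable b) (hc : Summable c) (hb0 : ∀ i, 0 ≤ b i) (hc0 : ∀ n, 0 ≤ c n)
    (h : ∀ i n, ‖F i n‖ ≤ b i * c n) :
    Summable (fun i => ∑' n, F i n) ∧ ∑' i, ∑' n, F i n = ∑' n, ∑' i, F i n := by
  have hF : Summable (Function.uncurry F) :=
    Summable.of_norm_bounded (hb.mul_of_nonneg hc hb0 hc0) fun p => h p.1 p.2
  exact ⟨hF.prod, hF.tsum_comm.symm⟩

section Theta

variable {q : ℂ}

lemma qTheta_mul_self (hq : ‖q‖ < 1) (hq0 : q ≠ 0) {y : ℂ} (hy : y ≠ 0) :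
    qTheta q (y * q) * -y = qTheta q y := by
  rw [qTheta, qTheta, qPochInf_eq_one_sub_mul hq y, show q / (y * q) = 1 / y by field_simp,
    qPochInf_eq_one_sub_mul hq (1 / y), show 1 / y * q = q / y by ring]
  field_simp
  ring

lemma qTheta_mul_pow (hq : ‖q‖ < 1) (hq0 : q ≠ 0) {y : ℂ} (hy : y ≠ 0) (n : ℕ) :
    qTheta q (y * q ^ n) * q ^ n.choose 2 * (-y) ^ n = qTheta q y := by
  induction n with
  | zero => simp
  | succ n ih =>
    rw [← ih, ← qTheta_mul_self hq hq0 (mul_ne_zero hy (pow_ne_zero n hq0)), choose_two_succ,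
      mul_assoc y, ← pow_succ]
    ring

/-- Shifting two arguments of the theta function by the same power of `q`. -/
lemma qTheta_mul_zpow_mul_qTheta (hq : ‖q‖ < 1) (hq0 : q ≠ 0) {x y : ℂ} (hx : x ≠ 0) (hy : y ≠ 0)
    (k : ℤ) :
    qTheta q (x * q ^ k) * qTheta q y * x ^ k = qTheta q (y * q ^ k) * qTheta q x * y ^ k := by
  obtain ⟨n, rfl | rfl⟩ := k.eq_nat_or_neg
  · simp only [zpow_natCast]
    have h1 := qTheta_mul_pow hq hq0 hx n
    have h2 := qTheta_mul_pow hq hq0 hy n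
    rw [← h1, ← h2, neg_pow x, neg_pow y]
    ring
  · have h : ∀ {x : ℂ}, x ≠ 0 → qTheta q (x * q ^ (-(n : ℤ))) * x ^ (-(n : ℤ)) =
        qTheta q x * (q ^ n.choose 2 * (-1) ^ n * (q ^ n) ^ (-(n : ℤ))) := by
      intro x hx
      have h := qTheta_mul_pow hq hq0 (mul_ne_zero hx (zpow_ne_zero (-(n : ℤ)) hq0)) n
      have hqn : q ^ n ≠ 0 := pow_ne_zero n hq0
      have e : x * q ^ (-(n : ℤ)) * q ^ n = x := by
        rw [zpow_neg, zpow_natCast]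
        field_simp
      rw [e] at h
      rw [← h, neg_pow, mul_pow]
      simp only [zpow_neg, zpow_natCast]
      have hxn : x ^ n ≠ 0 := pow_ne_zero n hx
      rw [inv_pow]
      field_simp
    linear_combination qTheta q y * h hx - qTheta q x * h hy

end Theta

section Orthogonality

variable {q a γ : ℝ}

/-- The transform of the big `q`-Bessel function with kernel `(a γ q^m x;q)_∞`. -/
lemma tsum_besselMass_mul_besselKernel_mul_bigQBessel (hq0 : 0 < q) (hq1 : q < 1) (ha0 : 0 < a)
    (ha1 : a < 1) (hγ : 0 < γ) (m l : ℤ) {d : ℂ}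
    (hd : d = (q : ℂ) / (a * γ) * (q : ℂ) ^ (-m)) :
    ∑' i, besselMass (q : ℂ) a γ i * besselKernel (q : ℂ) a γ m (besselNode (q : ℂ) a γ i) *
        bigQBessel (q : ℂ) a (γ * (q : ℂ) ^ l) (besselNode (q : ℂ) a γ i) =
      d * qPochInf (q : ℂ) q * qTheta (q : ℂ) (-1 / d) /
        (qPochInf (a : ℂ) q * qPochInf (-a * d) q) * qPochInf ((q : ℂ) ^ (l - m + 1)) q := by
  have hqc : ‖(q : ℂ)‖ < 1 := by simpa [abs_of_pos hq0] using hq1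
  have hac : ‖(a : ℂ)‖ < 1 := by simpa [abs_of_pos ha0] using ha1
  have hq' : (q : ℂ) ≠ 0 := by exact_mod_cast hq0.ne'
  have ha' : (a : ℂ) ≠ 0 := by exact_mod_cast ha0.ne'
  have hγ' : (γ : ℂ) ≠ 0 := by exact_mod_cast hγ.ne'
  have hd0 : d ≠ 0 := by
    rw [hd]
    exact mul_ne_zero (div_ne_zero hq' (mul_ne_zero ha' hγ')) (zpow_ne_zero _ hq')
  have hA := qPochInf_ne_zero_of_norm_lt_one hqc hac
  have had : qPochInf (-(a : ℂ) * d) q ≠ 0 := by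
    have hpos : 0 < a * (q / (a * γ) * q ^ (-m)) := by positivity
    have h := qPochInf_neg_ofReal_ne_zero hq0 hq1 hpos
    rw [hd, neg_mul]
    exact_mod_cast h
  obtain ⟨T, hT, hsum⟩ := exists_summable_besselMass_mul hq0 hq1 ha0 ha1 hγ
  obtain ⟨C, hC, hC'⟩ := exists_norm_besselKernel_node_le hqc hq' ha' hγ' m hT
  have hb := (hsum _ C hC hC').norm
  set X : ℝ := 1 + ‖(q : ℂ) / (a * γ)‖ * ‖(q : ℂ) ^ (-m)‖ + 1
  have hX : 0 ≤ X := by positivity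
  have hc := summable_norm_besselCoeff hqc hac (γ * (q : ℂ) ^ l) X
  rw [abs_of_nonneg hX] at hc
  have hF := (summable_and_tsum_comm_of_norm_le (F := fun i n =>
    besselMass (q : ℂ) a γ i * besselKernel (q : ℂ) a γ m (besselNode (q : ℂ) a γ i) *
      (besselCoeff (q : ℂ) a (γ * (q : ℂ) ^ l) n *
        qBinomProd (q : ℂ) (besselNode (q : ℂ) a γ i) 1 n))
    hb hc (fun _ => norm_nonneg _) (fun n => by positivity) fun i n => ?_).2
  · simp only [tsum_mul_left] at hF
    simp only [← bigQBessel_eq_tsum (besselNode_ne_zero hq' ha' hγ' _)] at hF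
    rw [hF, ← (hasSum_eulerCoeff hqc ((q : ℂ) ^ (l - m + 1))).tsum_eq, ← tsum_mul_left]
    refine tsum_congr fun n => ?_
    have hAn := qPochInf_eq_qPoch_mul hqc (a : ℂ) n
    have hAn' := hA
    rw [hAn] at hAn'
    have hK := tsum_besselMass_mul_besselKernel_mul_qBinomProd hqc hq' ha' hγ' m n hd
      (right_ne_zero_of_mul hAn') had
    have hθ := qTheta_mul_pow hqc hq' (div_ne_zero (neg_ne_zero.2 one_ne_zero) hd0) n
    have hθ' : qTheta (q : ℂ) (-(q : ℂ) ^ n / d) * (q : ℂ) ^ n.choose 2 =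
        qTheta (q : ℂ) (-1 / d) * d ^ n := by
      rw [← hθ, show -1 / d * (q : ℂ) ^ n = -(q : ℂ) ^ n / d by ring, mul_assoc _ _ (d ^ n),
        ← mul_pow, show -(-1 / d) * d = 1 by field_simp, one_pow, mul_one]
    have hpow : (q : ℂ) ^ (l - m + 1) = a * (γ * (q : ℂ) ^ l) * d := by
      rw [hd, zpow_add₀ hq', zpow_sub₀ hq', zpow_neg]
      field_simp
    calc _ = besselCoeff (q : ℂ) a (γ * (q : ℂ) ^ l) n *
          ∑' i, besselMass (q : ℂ) a γ i * besselKernel (q : ℂ) a γ m (besselNode (q : ℂ) a γ i) *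
            qBinomProd (q : ℂ) (besselNode (q : ℂ) a γ i) 1 n := by
          rw [← tsum_mul_left]
          exact tsum_congr fun i => by ring
      _ = eulerCoeff (q : ℂ) n * (-(a * (γ * (q : ℂ) ^ l))) ^ n * d * qPochInf (q : ℂ) q *
          (qTheta (q : ℂ) (-(q : ℂ) ^ n / d) * (q : ℂ) ^ n.choose 2) /
          (qPoch (a : ℂ) q n * qPochInf (a * (q : ℂ) ^ n) q * qPochInf (-(a : ℂ) * d) q) := by
          rw [hK, besselCoeff]
          ring
      _ = _ := by
          rw [hθ', ← hAn, hpow, neg_pow, neg_pow (_ * d), mul_pow _ d]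
          ring
  · have h := norm_besselKernel_mul_qBinomProd_le hqc hq' ha' hγ' m n i
    calc _ = ‖besselMass (q : ℂ) a γ i‖ * ‖besselCoeff (q : ℂ) a (γ * (q : ℂ) ^ l) n‖ *
          ‖besselKernel (q : ℂ) a γ m (besselNode (q : ℂ) a γ i) *
            qBinomProd (q : ℂ) (besselNode (q : ℂ) a γ i) 1 n‖ := by
          simp only [norm_mul]
          ring
      _ ≤ ‖besselMass (q : ℂ) a γ i‖ * ‖besselCoeff (q : ℂ) a (γ * (q : ℂ) ^ l) n‖ * _ :=
          mul_le_mul_of_nonneg_left h (by positivity)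
      _ = _ := by
          rw [norm_mul]
          ring

lemma summable_besselMass_mul_bigQBessel_mul (hq0 : 0 < q) (hq1 : q < 1) (ha0 : 0 < a)
    (ha1 : a < 1) (hγ : 0 < γ) (k l : ℤ) :
    Summable fun i => besselMass (q : ℂ) a γ i *
      bigQBessel (q : ℂ) a (γ * (q : ℂ) ^ k) (besselNode (q : ℂ) a γ i) *
      bigQBessel (q : ℂ) a (γ * (q : ℂ) ^ l) (besselNode (q : ℂ) a γ i) := by
  have hqc : ‖(q : ℂ)‖ < 1 := by simpa [abs_of_pos hq0] using hq1
  have hac : ‖(a : ℂ)‖ < 1 := by simpa [abs_of_pos ha0] using ha1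
  have hq' : (q : ℂ) ≠ 0 := by exact_mod_cast hq0.ne'
  have ha' : (a : ℂ) ≠ 0 := by exact_mod_cast ha0.ne'
  have hγ' : (γ : ℂ) ≠ 0 := by exact_mod_cast hγ.ne'
  obtain ⟨T, hT, hsum⟩ := exists_summable_besselMass_mul hq0 hq1 ha0 ha1 hγ
  obtain ⟨C, hC, hC'⟩ := exists_norm_bigQBessel_node_le hqc hq' ha' hac hγ' k hT
  obtain ⟨D, hD, -⟩ := exists_norm_bigQBessel_node_le hqc hq' ha' hac hγ' l hT
  have hC0 : 0 ≤ C := (norm_nonneg _).trans (hC (Sum.inl 0))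
  have hT0 : 0 < T := zero_lt_one.trans_le hT
  simp only [mul_assoc (besselMass _ _ _ _)]
  refine hsum _ (C * D) (fun i => ?_) fun j => ?_
  · rw [norm_mul]
    exact mul_le_mul (hC i) (hD i) (norm_nonneg _) hC0
  · rw [norm_mul, mul_right_comm]
    exact mul_le_mul (hC' j) (hD _) (norm_nonneg _) (by positivity)

lemma qPochInf_mul_tsum_besselMass_mul_bigQBessel_mul (hq0 : 0 < q) (hq1 : q < 1) (ha0 : 0 < a)
    (ha1 : a < 1) (hγ : 0 < γ) (k l : ℤ) :
    qPochInf (a : ℂ) q * ∑' i, besselMass (q : ℂ) a γ i *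
        bigQBessel (q : ℂ) a (γ * (q : ℂ) ^ k) (besselNode (q : ℂ) a γ i) *
        bigQBessel (q : ℂ) a (γ * (q : ℂ) ^ l) (besselNode (q : ℂ) a γ i) =
      ∑' m : ℕ, besselDualCoeff (q : ℂ) a (γ * (q : ℂ) ^ k) m *
        ∑' i, besselMass (q : ℂ) a γ i *
          besselKernel (q : ℂ) a γ (k + m) (besselNode (q : ℂ) a γ i) *
          bigQBessel (q : ℂ) a (γ * (q : ℂ) ^ l) (besselNode (q : ℂ) a γ i) := by
  have hqc : ‖(q : ℂ)‖ < 1 := by simpa [abs_of_pos hq0] using hq1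
  have hac : ‖(a : ℂ)‖ < 1 := by simpa [abs_of_pos ha0] using ha1
  have hq' : (q : ℂ) ≠ 0 := by exact_mod_cast hq0.ne'
  have ha' : (a : ℂ) ≠ 0 := by exact_mod_cast ha0.ne'
  have hγ' : (γ : ℂ) ≠ 0 := by exact_mod_cast hγ.ne'
  obtain ⟨T, hT, hsum⟩ := exists_summable_besselMass_mul hq0 hq1 ha0 ha1 hγ
  obtain ⟨C, hC, hC'⟩ := exists_norm_bigQBessel_node_le hqc hq' ha' hac hγ' l hT
  have hb := (hsum _ C hC hC').norm
  have hc := summable_norm_besselDualCoeff hqc a (γ * (q : ℂ) ^ k) 1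
  simp only [abs_one, one_pow, mul_one] at hc
  have hF := (summable_and_tsum_comm_of_norm_le (F := fun i (m : ℕ) =>
    besselMass (q : ℂ) a γ i * bigQBessel (q : ℂ) a (γ * (q : ℂ) ^ l) (besselNode (q : ℂ) a γ i) *
      (besselDualCoeff (q : ℂ) a (γ * (q : ℂ) ^ k) m *
        besselKernel (q : ℂ) a γ (k + m) (besselNode (q : ℂ) a γ i)))
    hb (hc.mul_right (Real.exp ((1 + ‖a * γ * (q : ℂ) ^ k‖) / (1 - ‖(q : ℂ)‖))))
    (fun _ => norm_nonneg _) (fun n => by positivity) fun i n => ?_).2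
  · simp only [tsum_mul_left] at hF
    simp only [← qPochInf_mul_bigQBessel_node hqc hq' ha' hac hγ'] at hF
    rw [← tsum_mul_left]
    refine ((tsum_congr fun i => ?_).trans hF).trans (tsum_congr fun m => ?_)
    · ring
    · rw [← tsum_mul_left]
      exact tsum_congr fun i => by ring
  · rw [norm_mul, norm_mul (besselDualCoeff _ _ _ _)]
    exact mul_le_mul_of_nonneg_left (mul_le_mul_of_nonneg_left
      (norm_besselKernel_le hqc hq' ha' hγ' k n i) (norm_nonneg _)) (norm_nonneg _)

lemma tsum_besselMass_mul_bigQBessel_mul_eq_zero (hq0 : 0 < q) (hq1 : q < 1) (ha0 : 0 < a)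
    (ha1 : a < 1) (hγ : 0 < γ) {k l : ℤ} (hlk : l < k) :
    ∑' i, besselMass (q : ℂ) a γ i *
        bigQBessel (q : ℂ) a (γ * (q : ℂ) ^ k) (besselNode (q : ℂ) a γ i) *
        bigQBessel (q : ℂ) a (γ * (q : ℂ) ^ l) (besselNode (q : ℂ) a γ i) = 0 := by
  have hqc : ‖(q : ℂ)‖ < 1 := by simpa [abs_of_pos hq0] using hq1
  have hac : ‖(a : ℂ)‖ < 1 := by simpa [abs_of_pos ha0] using ha1
  have hq' : (q : ℂ) ≠ 0 := by exact_mod_cast hq0.ne'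
  refine (mul_eq_zero.1 ?_).resolve_left (qPochInf_ne_zero_of_norm_lt_one hqc hac)
  rw [qPochInf_mul_tsum_besselMass_mul_bigQBessel_mul hq0 hq1 ha0 ha1 hγ]
  refine (tsum_congr fun m => ?_).trans tsum_zero
  rw [tsum_besselMass_mul_besselKernel_mul_bigQBessel hq0 hq1 ha0 ha1 hγ (k + m) l rfl,
    qPochInf_zpow_eq_zero hqc hq' (by omega), mul_zero, mul_zero]

lemma tsum_besselMass_mul_bigQBessel_sq (hq0 : 0 < q) (hq1 : q < 1) (ha0 : 0 < a)
    (ha1 : a < 1) (hγ : 0 < γ) (k : ℤ) :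
    ∑' i, besselMass (q : ℂ) a γ i *
        bigQBessel (q : ℂ) a (γ * (q : ℂ) ^ k) (besselNode (q : ℂ) a γ i) *
        bigQBessel (q : ℂ) a (γ * (q : ℂ) ^ k) (besselNode (q : ℂ) a γ i) =
      (a : ℂ) ^ (-k) * qPochInf (-((q : ℂ) ^ k * γ)) q * qPochInf (q : ℂ) q ^ 2 *
        qTheta (q : ℂ) (-(a * γ)) / (qPochInf (a : ℂ) q ^ 2 * qTheta (q : ℂ) (-γ)) := by
  have hqc : ‖(q : ℂ)‖ < 1 := by simpa [abs_of_pos hq0] using hq1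
  have hac : ‖(a : ℂ)‖ < 1 := by simpa [abs_of_pos ha0] using ha1
  have hq' : (q : ℂ) ≠ 0 := by exact_mod_cast hq0.ne'
  have ha' : (a : ℂ) ≠ 0 := by exact_mod_cast ha0.ne'
  have hγ' : (γ : ℂ) ≠ 0 := by exact_mod_cast hγ.ne'
  have hA := qPochInf_ne_zero_of_norm_lt_one hqc hac
  have hqk : (q : ℂ) ^ k ≠ 0 := zpow_ne_zero k hq'
  have hak : (a : ℂ) ^ k ≠ 0 := zpow_ne_zero k ha'
  obtain ⟨d, hd⟩ : ∃ d : ℂ, d = (q : ℂ) / (a * γ) * (q : ℂ) ^ (-k) := ⟨_, rfl⟩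
  have had : qPochInf (-(a : ℂ) * d) q ≠ 0 := by
    have hpos : 0 < a * (q / (a * γ) * q ^ (-k)) := by positivity
    have h := qPochInf_neg_ofReal_ne_zero hq0 hq1 hpos
    rw [hd, neg_mul]
    exact_mod_cast h
  have hθγ : qTheta (q : ℂ) (-γ) ≠ 0 := by
    have h := qPochInf_neg_ofReal_ne_zero hq0 hq1 (div_pos hq0 hγ)
    rw [Complex.ofReal_div, ← div_neg] at h
    exact mul_ne_zero (qPochInf_neg_ofReal_ne_zero hq0 hq1 hγ) h
  have hθ : d * qTheta (q : ℂ) (-1 / d) * qTheta (q : ℂ) (-γ) * (a : ℂ) ^ k =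
      qPochInf (-((q : ℂ) ^ k * γ)) q * qPochInf (-a * d) q * qTheta (q : ℂ) (-(a * γ)) := by
    have hx : -(a * γ / q : ℂ) ≠ 0 := neg_ne_zero.2 (div_ne_zero (mul_ne_zero ha' hγ') hq')
    have h1 := qTheta_mul_zpow_mul_qTheta hqc hq' hx (neg_ne_zero.2 hγ') k
    have h2 := qTheta_mul_self hqc hq' hx
    have h3 : qTheta (q : ℂ) (-γ * (q : ℂ) ^ k) =
        qPochInf (-((q : ℂ) ^ k * γ)) q * qPochInf (-a * d) q := by
      rw [qTheta, hd, zpow_neg]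
      congr 2
      · ring
      · field_simp
    have h4 : -1 / d = -(a * γ / q : ℂ) * (q : ℂ) ^ k := by
      rw [hd, zpow_neg]
      field_simp
    have h5 : (-(a * γ / q) : ℂ) ^ k = (-γ) ^ k * (a : ℂ) ^ k / (q : ℂ) ^ k := by
      rw [← mul_zpow, ← div_zpow]
      congr 1
      ring
    have hγk : (-γ : ℂ) ^ k ≠ 0 := zpow_ne_zero k (neg_ne_zero.2 hγ')
    rw [show -(a * γ / q : ℂ) * q = -(a * γ) by field_simp] at h2
    rw [h5, ← h2, ← h4] at h1
    rw [← h3]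
    generalize qTheta (q : ℂ) (-1 / d) = X at h1 ⊢
    rw [hd, zpow_neg]
    generalize (-γ : ℂ) ^ k = Y at h1 hγk
    field_simp at h1 ⊢
    linear_combination h1
  have hL := qPochInf_mul_tsum_besselMass_mul_bigQBessel_mul hq0 hq1 ha0 ha1 hγ k k
  rw [tsum_eq_single (0 : ℕ) fun (m : ℕ) hm => by
      rw [tsum_besselMass_mul_besselKernel_mul_bigQBessel hq0 hq1 ha0 ha1 hγ (k + m) k rfl,
        qPochInf_zpow_eq_zero hqc hq' (by omega), mul_zero, mul_zero],
    Nat.cast_zero, add_zero,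
    tsum_besselMass_mul_besselKernel_mul_bigQBessel hq0 hq1 ha0 ha1 hγ k k hd, sub_self, zero_add,
    zpow_one, show besselDualCoeff (q : ℂ) a (γ * (q : ℂ) ^ k) 0 = 1 by
      simp [besselDualCoeff, eulerCoeff], one_mul] at hL
  refine mul_left_cancel₀ hA (hL.trans ?_)
  rw [zpow_neg]
  generalize qTheta (q : ℂ) (-1 / d) = X at hθ ⊢
  generalize qPochInf (-(a : ℂ) * d) q = B at hθ had ⊢
  generalize qPochInf (-((q : ℂ) ^ k * γ)) q = Y at hθ ⊢
  field_simp
  linear_combination qPochInf (q : ℂ) q ^ 2 * hθ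

end Orthogonality

theorem bigQBessel_orthogonality (q a γ : ℝ) (hq0 : 0 < q) (hq1 : q < 1)
    (hγ : 0 < γ) (ha0 : 0 < a) (ha1 : a < 1) (k l : ℤ)
    (z : ℂ) (hz : z = (q : ℂ) / ((a : ℂ) * (γ : ℂ))) :
    Summable (fun j : ℕ => (q : ℂ) ^ j * bigQWeight (q : ℂ) (a : ℂ) (-(q : ℂ) ^ j) *
        bigQBessel (q : ℂ) (a : ℂ) ((γ : ℂ) * (q : ℂ) ^ k) (-(q : ℂ) ^ j) *
        bigQBessel (q : ℂ) (a : ℂ) ((γ : ℂ) * (q : ℂ) ^ l) (-(q : ℂ) ^ j)) ∧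
    Summable (fun j : ℤ => (q : ℂ) ^ j * bigQWeight (q : ℂ) (a : ℂ) (z * (q : ℂ) ^ j) *
        bigQBessel (q : ℂ) (a : ℂ) ((γ : ℂ) * (q : ℂ) ^ k) (z * (q : ℂ) ^ j) *
        bigQBessel (q : ℂ) (a : ℂ) ((γ : ℂ) * (q : ℂ) ^ l) (z * (q : ℂ) ^ j)) ∧
    (1 - (q : ℂ)) *
        ((∑' j : ℕ, (q : ℂ) ^ j * bigQWeight (q : ℂ) (a : ℂ) (-(q : ℂ) ^ j) *
            bigQBessel (q : ℂ) (a : ℂ) ((γ : ℂ) * (q : ℂ) ^ k) (-(q : ℂ) ^ j) *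
            bigQBessel (q : ℂ) (a : ℂ) ((γ : ℂ) * (q : ℂ) ^ l) (-(q : ℂ) ^ j)) +
          z * ∑' j : ℤ, (q : ℂ) ^ j * bigQWeight (q : ℂ) (a : ℂ) (z * (q : ℂ) ^ j) *
            bigQBessel (q : ℂ) (a : ℂ) ((γ : ℂ) * (q : ℂ) ^ k) (z * (q : ℂ) ^ j) *
            bigQBessel (q : ℂ) (a : ℂ) ((γ : ℂ) * (q : ℂ) ^ l) (z * (q : ℂ) ^ j)) =
      (if k = l then 1 else 0) * (1 - (q : ℂ)) * (a : ℂ) ^ (-k) *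
        qPochInf (-((q : ℂ) ^ k * (γ : ℂ))) (q : ℂ) * (qPochInf (q : ℂ) (q : ℂ)) ^ 2 *
        qTheta (q : ℂ) (-((a : ℂ) * (γ : ℂ))) /
        ((qPochInf (a : ℂ) (q : ℂ)) ^ 2 * qTheta (q : ℂ) (-(γ : ℂ))) := by
  have hz0 : z ≠ 0 := by
    rw [hz]
    exact_mod_cast (div_pos hq0 (mul_pos ha0 hγ)).ne'
  have hval : ∑' i, besselMass (q : ℂ) a γ i *
      bigQBessel (q : ℂ) a (γ * (q : ℂ) ^ k) (besselNode (q : ℂ) a γ i) *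
      bigQBessel (q : ℂ) a (γ * (q : ℂ) ^ l) (besselNode (q : ℂ) a γ i) =
      if k = l then (a : ℂ) ^ (-k) * qPochInf (-((q : ℂ) ^ k * γ)) q * qPochInf (q : ℂ) q ^ 2 *
        qTheta (q : ℂ) (-(a * γ)) / (qPochInf (a : ℂ) q ^ 2 * qTheta (q : ℂ) (-γ)) else 0 := by
    rcases lt_trichotomy k l with h | rfl | h
    · rw [if_neg h.ne]
      simpa only [mul_right_comm (besselMass _ _ _ _)] using
        tsum_besselMass_mul_bigQBessel_mul_eq_zero hq0 hq1 ha0 ha1 hγ h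
    · rw [if_pos rfl]
      exact tsum_besselMass_mul_bigQBessel_sq hq0 hq1 ha0 ha1 hγ k
    · rw [if_neg h.ne']
      exact tsum_besselMass_mul_bigQBessel_mul_eq_zero hq0 hq1 ha0 ha1 hγ h
  have hS := summable_besselMass_mul_bigQBessel_mul hq0 hq1 ha0 ha1 hγ k l
  have hl := hS.comp_injective Sum.inl_injective
  have hr := hS.comp_injective Sum.inr_injective
  have hsum := (hl.hasSum.sum (f := fun i => besselMass (q : ℂ) a γ i *
      bigQBessel (q : ℂ) a (γ * (q : ℂ) ^ k) (besselNode (q : ℂ) a γ i) *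
      bigQBessel (q : ℂ) a (γ * (q : ℂ) ^ l) (besselNode (q : ℂ) a γ i)) hr.hasSum).tsum_eq
  rw [hval] at hsum
  simp only [Function.comp_def, besselMass, besselNode, Sum.elim_inl, Sum.elim_inr, ← hz,
    mul_assoc z] at hl hr hsum
  rw [tsum_mul_left] at hsum
  refine ⟨hl, (summable_mul_left_iff hz0).1 hr, ?_⟩
  rw [← hsum]
  split_ifs <;> ring
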